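/- arXiv:1804.07679 — 3 statements merged into one kernel-verified Lean document; each statement's English description precedes it below -/
import Mathlib

section
/- Let (a_n : n ∈ ℤ) ⊆ (0,∞) satisfy 1 < a ≤ a_{n+1}/a_n ≤ a² for all n ∈ ℤ, and set S_n = P_{a_n} − P_{a_{n-1}} for n ∈ ℤ. Then for every p ∈ (1, ∞) there exists a constant C_p > 0 independent of the dimension d ∈ ℕ such that for every f ∈ ℓ^p(ℤ^d) one has the Littlewood–Paley estimate ‖ (Σ_{n∈ℤ} |S_n f|²)^{1/2} ‖_{ℓ^p(ℤ^d)} ≤ C_p · a · ‖f‖_{ℓ^p(ℤ^d)}. -/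
open MeasureTheory ENNReal

/-- The ℓ^p(ℤ^d) "norm" of a nonnegative (ℝ≥0∞-valued) function, `p ∈ (0,∞]`. -/
noncomputable def lpZ (d : ℕ) (p : ℝ≥0∞) (g : (Fin d → ℤ) → ℝ≥0∞) : ℝ≥0∞ :=
  if p = ∞ then ⨆ x, g x else (∑' x, g x ^ p.toReal) ^ (1 / p.toReal)

/-- `x ↦ ‖f x‖₊` as an ℝ≥0∞-valued function. -/
noncomputable def nnC {d : ℕ} (f : (Fin d → ℤ) → ℂ) : (Fin d → ℤ) → ℝ≥0∞ :=
  fun x => (‖f x‖₊ : ℝ≥0∞)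

/-- `|ξ|_sin = (Σ_k sin²(πξ_k))^{1/2}`. -/
noncomputable def sinNorm (d : ℕ) (ξ : Fin d → ℝ) : ℝ :=
  Real.sqrt (∑ k, Real.sin (Real.pi * ξ k) ^ 2)

/-- The convolution kernel of the discrete Poisson semigroup `P_t`. -/
noncomputable def poissonKer (d : ℕ) (t : ℝ) (z : Fin d → ℤ) : ℂ :=
  ∫ ξ in Set.Icc (fun _ => -(1 / 2 : ℝ)) (fun _ => (1 / 2 : ℝ)),
    Complex.exp (-(t : ℂ) * (sinNorm d ξ : ℂ)
      - 2 * Real.pi * Complex.I * ∑ k, (z k : ℂ) * (ξ k : ℂ))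

/-- The discrete Poisson semigroup `P_t` on ℤ^d, as a convolution operator. -/
noncomputable def poisson (d : ℕ) (t : ℝ) (f : (Fin d → ℤ) → ℂ) (x : Fin d → ℤ) : ℂ :=
  ∑' y, poissonKer d t (x - y) * f y

section KernelSec
attribute [local instance] instMeasureSpaceUnitAddCircle
open UnitAddTorus

instance myprob : IsProbabilityMeasure (volume : Measure UnitAddCircle) :=
  inferInstanceAs (IsProbabilityMeasure AddCircle.haarAddCircle)
instance myhaar : Measure.IsAddHaarMeasure (volume : Measure UnitAddCircle) :=
  inferInstanceAs (Measure.IsAddHaarMeasure AddCircle.haarAddCircle)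

/-- Fourier coefficient as a continuous linear functional. -/
noncomputable def coeffL (d : ℕ) (z : Fin d → ℤ) : C(UnitAddTorus (Fin d), ℂ) →L[ℂ] ℂ :=
  (innerSL ℂ (mFourierLp (d := Fin d) 2 z)).comp (ContinuousMap.toLp 2 volume ℂ)

lemma coeffL_eq (d : ℕ) (z : Fin d → ℤ) (f : C(UnitAddTorus (Fin d), ℂ)) : coeffL d z f = mFourierCoeff f z := by
  rw [← mFourierCoeff_toLp, ← mFourierBasis_repr, mFourierBasis.repr_apply_apply,
    coe_mFourierBasis]
  rfl

lemma coeffL_mFourier (d : ℕ) (z w : Fin d → ℤ) :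
    coeffL d z (mFourier w) = if z = w then 1 else 0 := by
  have := (orthonormal_iff_ite.mp (orthonormal_mFourier (d := Fin d))) z w
  exact this

lemma coeffL_mul_mFourier (d : ℕ) (z w : Fin d → ℤ) (g : C(UnitAddTorus (Fin d), ℂ)) :
    coeffL d z (mFourier w * g) = coeffL d (z - w) g := by
  rw [coeffL_eq, coeffL_eq]
  unfold mFourierCoeff
  congr 1
  funext t
  rw [show -(z - w) = -z + w by abel, mFourier_add]
  simp [mul_assoc]

/-- monomials with nonnegative coefficients -/
noncomputable def monoM (d : ℕ) : Submonoid C(UnitAddTorus (Fin d), ℂ) where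
  carrier := {f | ∃ (c : ℝ) (z : Fin d → ℤ), 0 ≤ c ∧ f = (c : ℂ) • mFourier z}
  one_mem' := ⟨1, 0, zero_le_one, by simp [mFourier_zero]⟩
  mul_mem' := by
    rintro _ _ ⟨c, z, hc, rfl⟩ ⟨c', z', hc', rfl⟩
    refine ⟨c * c', z + z', mul_nonneg hc hc', ?_⟩
    ext x
    simp [mFourier_add]; ring

/-- closure of positive trigonometric polynomials -/
noncomputable def posQ (d : ℕ) : Subsemiring C(UnitAddTorus (Fin d), ℂ) :=
  (monoM d).subsemiringClosure.topologicalClosure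

lemma posQ_mono (d : ℕ) (c : ℝ) (hc : 0 ≤ c) (z : Fin d → ℤ) :
    (c : ℂ) • mFourier z ∈ posQ d := by
  apply Subsemiring.le_topologicalClosure
  rw [Submonoid.subsemiringClosure_mem]
  exact AddSubmonoid.subset_closure ⟨c, z, hc, rfl⟩

lemma posQ_closed (d : ℕ) : IsClosed (posQ d : Set C(UnitAddTorus (Fin d), ℂ)) :=
  Subsemiring.isClosed_topologicalClosure _

lemma posQ_const (d : ℕ) (c : ℝ) (hc : 0 ≤ c) : (c : ℂ) • (1 : C(UnitAddTorus (Fin d), ℂ)) ∈ posQ d := by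
  have := posQ_mono d c hc 0
  rwa [mFourier_zero] at this

lemma posQ_smul (d : ℕ) (c : ℝ) (hc : 0 ≤ c) (f : C(UnitAddTorus (Fin d), ℂ)) (hf : f ∈ posQ d) :
    (c : ℂ) • f ∈ posQ d := by
  have := (posQ d).mul_mem (posQ_const d c hc) hf
  simpa using this

lemma posQ_induct (d : ℕ) (S : AddSubmonoid C(UnitAddTorus (Fin d), ℂ)) (hS : IsClosed (S : Set C(UnitAddTorus (Fin d), ℂ)))
    (h : ∀ (c : ℝ) (z : Fin d → ℤ), 0 ≤ c → (c : ℂ) • mFourier z ∈ S) :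
    ∀ f ∈ posQ d, f ∈ S := by
  intro f hf
  have h1 : ((monoM d).subsemiringClosure : Set C(UnitAddTorus (Fin d), ℂ)) ⊆ S := by
    intro g hg
    have hg' : g ∈ AddSubmonoid.closure (monoM d : Set C(UnitAddTorus (Fin d), ℂ)) := by
      rwa [← Submonoid.subsemiringClosure_mem]
    have : AddSubmonoid.closure (monoM d : Set C(UnitAddTorus (Fin d), ℂ)) ≤ S := by
      rw [AddSubmonoid.closure_le]
      rintro _ ⟨c, z, hc, rfl⟩
      exact h c z hc
    exact this hg'
  exact closure_minimal h1 hS hf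

lemma posQ_coeff (d : ℕ) (z : Fin d → ℤ) (f : C(UnitAddTorus (Fin d), ℂ)) (hf : f ∈ posQ d) :
    0 ≤ (coeffL d z f).re ∧ (coeffL d z f).im = 0 := by
  let S : AddSubmonoid C(UnitAddTorus (Fin d), ℂ) :=
    { carrier := {f | 0 ≤ (coeffL d z f).re ∧ (coeffL d z f).im = 0}
      zero_mem' := by simp
      add_mem' := by
        rintro a b ⟨h1, h2⟩ ⟨h3, h4⟩
        simp only [Set.mem_ofPred_eq, map_add, Complex.add_re, Complex.add_im]
        exact ⟨add_nonneg h1 h3, by rw [h2, h4, add_zero]⟩ }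
  refine posQ_induct d S ?_ ?_ f hf
  · change IsClosed ({f | 0 ≤ (coeffL d z f).re} ∩ {f | (coeffL d z f).im = 0})
    refine IsClosed.inter (isClosed_le continuous_const ?_) (isClosed_eq ?_ continuous_const)
    · exact Complex.continuous_re.comp (coeffL d z).continuous
    · exact Complex.continuous_im.comp (coeffL d z).continuous
  · intro c w hc
    change 0 ≤ (coeffL d z _).re ∧ (coeffL d z _).im = 0
    rw [map_smul, coeffL_mFourier]
    split_ifs <;> simp [hc]

lemma posQ_sum (d : ℕ) (s : Finset (Fin d → ℤ)) (f : C(UnitAddTorus (Fin d), ℂ)) (hf : f ∈ posQ d) :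
    ∑ z ∈ s, (coeffL d z f).re ≤ (f 0).re := by
  let S : AddSubmonoid C(UnitAddTorus (Fin d), ℂ) :=
    { carrier := {f | ∑ z ∈ s, (coeffL d z f).re ≤ (f 0).re}
      zero_mem' := by simp
      add_mem' := by
        intro a b h1 h2
        simp only [Set.mem_ofPred_eq, map_add, Complex.add_re, Finset.sum_add_distrib,
          ContinuousMap.add_apply] at *
        exact add_le_add h1 h2 }
  refine posQ_induct d S ?_ ?_ f hf
  · change IsClosed {f : C(UnitAddTorus (Fin d), ℂ) | ∑ z ∈ s, (coeffL d z f).re ≤ (f 0).re}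
    refine (isClosed_le ?_ ?_)
    · exact continuous_finsetSum _ fun z _ => Complex.continuous_re.comp (coeffL d z).continuous
    · exact Complex.continuous_re.comp (ContinuousMap.evalCLM ℂ (0 : UnitAddTorus (Fin d))).continuous
  · intro c w hc
    change ∑ z ∈ s, (coeffL d z _).re ≤ _
    have h0 : (mFourier w : C(UnitAddTorus (Fin d), ℂ)) 0 = 1 := by
      simp [mFourier]
    simp only [map_smul, coeffL_mFourier, ContinuousMap.smul_apply, h0]
    simp only [smul_eq_mul, mul_ite, mul_one, mul_zero]
    have : ∀ z, (if z = w then (c : ℂ) else 0).re = if z = w then c else 0 := by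
      intro z; split_ifs <;> simp
    simp only [this, Finset.sum_ite_eq', Complex.ofReal_re]
    split_ifs <;> simp [hc]

lemma posQ_exp (d : ℕ) (f g : C(UnitAddTorus (Fin d), ℂ)) (hf : f ∈ posQ d) (hg : ∀ x, g x = Complex.exp (f x)) :
    g ∈ posQ d := by
  have h1 : HasSum (fun n : ℕ => ((n.factorial : ℂ)⁻¹) • f ^ n) (NormedSpace.exp f) :=
    NormedSpace.exp_series_hasSum_exp' (𝕂 := ℂ) f
  have h2 : NormedSpace.exp f = g := by
    ext x
    have h3 := (ContinuousMap.evalCLM ℂ x).hasSum h1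
    have h4 : HasSum (fun n : ℕ => ((n.factorial : ℂ)⁻¹) • (f x) ^ n) (NormedSpace.exp (f x)) :=
      NormedSpace.exp_series_hasSum_exp' (𝕂 := ℂ) (f x)
    rw [hg, Complex.exp_eq_exp_ℂ]
    refine HasSum.unique h3 ?_
    exact h4
  rw [← h2]
  refine (posQ_closed d).mem_of_tendsto h1 (Filter.Eventually.of_forall fun s => ?_)
  refine (posQ d).sum_mem fun n _ => ?_
  have := posQ_smul d ((n.factorial : ℝ)⁻¹) (by positivity) _ ((posQ d).pow_mem hf n)
  simpa using this

/-- sum of squared sines on the torus -/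
noncomputable def lamT (d : ℕ) (x : UnitAddTorus (Fin d)) : ℝ := ∑ k, (1 - (fourier 1 (x k)).re) / 2

lemma lamT_cont (d : ℕ) : Continuous (lamT d) := by
  unfold lamT; fun_prop

lemma lamT_nonneg (d : ℕ) (x : UnitAddTorus (Fin d)) : 0 ≤ lamT d x := by
  refine Finset.sum_nonneg fun k _ => ?_
  have : (fourier 1 (x k) : ℂ).re ≤ 1 := by
    refine (Complex.re_le_norm _).trans ?_
    simp [fourier_apply, Circle.norm_coe]
  linarith

lemma lamT_le (d : ℕ) (x : UnitAddTorus (Fin d)) : lamT d x ≤ d := by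
  unfold lamT
  have : ∑ k : Fin d, (1 - (fourier 1 (x k) : ℂ).re) / 2 ≤ ∑ k : Fin d, (1:ℝ) := by
    refine Finset.sum_le_sum fun k _ => ?_
    have : -1 ≤ (fourier 1 (x k) : ℂ).re := by
      have := Complex.abs_re_le_norm (fourier 1 (x k) : ℂ)
      have h2 : ‖(fourier 1 (x k) : ℂ)‖ = 1 := by simp [fourier_apply, Circle.norm_coe]
      rw [h2] at this
      exact (abs_le.1 this).1
    linarith
  simpa using this

noncomputable def cT (d : ℕ) : C(UnitAddTorus (Fin d), ℂ) :=
  ⟨fun x => ((1 - lamT d x / (d + 1) : ℝ) : ℂ), by have := lamT_cont d; fun_prop⟩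

lemma cT_mem (d : ℕ) : cT d ∈ posQ d := by
  have h : cT d = ((1 - d / (2 * (d + 1)) : ℝ) : ℂ) • (1 : C(UnitAddTorus (Fin d), ℂ)) +
      ∑ k : Fin d, (((1 / (4 * (d + 1)) : ℝ) : ℂ) • mFourier (Pi.single k 1) +
        ((1 / (4 * (d + 1)) : ℝ) : ℂ) • mFourier (-Pi.single k 1)) := by
    ext x
    simp only [ContinuousMap.add_apply, ContinuousMap.smul_apply, ContinuousMap.sum_apply,
      ContinuousMap.one_apply, mFourier_neg, mFourier_single]
    simp only [← smul_add, Complex.add_conj]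
    change (((1 - lamT d x / (d + 1) : ℝ)) : ℂ) = _
    simp only [smul_eq_mul]
    rw [← Finset.mul_sum]
    norm_cast
    simp only [lamT, ← Finset.sum_div, ← Finset.mul_sum, Finset.sum_sub_distrib]
    simp
    field_simp
    ring
  rw [h]
  refine (posQ d).add_mem (posQ_const d _ ?_) ((posQ d).sum_mem fun k _ =>
    (posQ d).add_mem (posQ_mono d _ (by positivity) _) (posQ_mono d _ (by positivity) _))
  rw [sub_nonneg, div_le_one (by positivity)]
  have : (0:ℝ) ≤ d := by positivity
  linarith

noncomputable def sgT (d : ℕ) : C(UnitAddTorus (Fin d), ℂ) :=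
  ⟨fun x => ((1 - Real.sqrt (lamT d x / (d + 1)) : ℝ) : ℂ), by have := lamT_cont d; fun_prop⟩

noncomputable def iterT (d : ℕ) : ℕ → C(UnitAddTorus (Fin d), ℂ)
  | 0 => 0
  | n + 1 => ((1 / 2 : ℝ) : ℂ) • (cT d + iterT d n ^ 2)

lemma iterT_mem (d n : ℕ) : iterT d n ∈ posQ d := by
  induction n with
  | zero => exact (posQ d).zero_mem
  | succ n ih =>
    exact posQ_smul d _ (by norm_num) _ ((posQ d).add_mem (cT_mem d) ((posQ d).pow_mem ih 2))

lemma iter_real (l : ℝ) (h0 : 0 ≤ l) (h1 : l ≤ 1) (s : ℕ → ℝ) (s0 : s 0 = 0)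
    (hs : ∀ n, s (n + 1) = 1 / 2 * ((1 - l) + s n ^ 2)) (n : ℕ) :
    0 ≤ s n ∧ s n ≤ 1 - Real.sqrt l ∧ (1 - Real.sqrt l) - s n ≤ 2 / (n + 2) := by
  have hq0 := Real.sqrt_nonneg l
  have hq1 : Real.sqrt l ≤ 1 := Real.sqrt_le_one.2 h1
  have hq2 := Real.sq_sqrt h0
  set y := Real.sqrt l
  induction n with
  | zero => rw [s0]; refine ⟨le_rfl, by linarith, ?_⟩; simp; linarith
  | succ n ih =>
    obtain ⟨i1, i2, i3⟩ := ih
    rw [hs]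
    refine ⟨by nlinarith, by nlinarith, ?_⟩
    set D := (1 - y) - s n with hD
    have e : 1 - y - 1 / 2 * (1 - l + s n ^ 2) = D * (1 - y) - D ^ 2 / 2 := by
      rw [← hq2, hD]; ring
    rw [e]
    have hD0 : 0 ≤ D := by linarith
    have hn : (0:ℝ) < n + 2 := by positivity
    set X := (2:ℝ) / (n + 2) with hX
    have hX1 : X ≤ 1 := by rw [hX, div_le_one hn]; have : (0:ℝ) ≤ n := by positivity
                           linarith
    have h5 : D * (1 - y) - D ^ 2 / 2 ≤ X - X ^ 2 / 2 := by nlinarith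
    refine h5.trans ?_
    rw [hX]; push_cast
    rw [div_pow, div_sub' (by positivity), div_le_div_iff₀ (by positivity) (by positivity)]
    have : (0:ℝ) ≤ n := by positivity
    field_simp
    nlinarith

lemma iterT_real (d : ℕ) (x : UnitAddTorus (Fin d)) : ∃ s : ℕ → ℝ, s 0 = 0 ∧
    (∀ n, s (n + 1) = 1 / 2 * ((1 - lamT d x / (d + 1)) + s n ^ 2)) ∧
    ∀ n, iterT d n x = s n := by
  let s : ℕ → ℝ := fun n => Nat.rec 0 (fun _ y => 1 / 2 * ((1 - lamT d x / (d + 1)) + y ^ 2)) n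
  refine ⟨s, rfl, fun n => rfl, fun n => ?_⟩
  induction n with
  | zero => simp [iterT, s]
  | succ n ih =>
    change ((1 / 2 : ℝ) : ℂ) • (cT d x + iterT d n x ^ 2) = _
    rw [ih]
    change ((1 / 2 : ℝ) : ℂ) • (((1 - lamT d x / (d + 1) : ℝ) : ℂ) + _) =
      ((1 / 2 * ((1 - lamT d x / (d + 1)) + s n ^ 2) : ℝ) : ℂ)
    push_cast; simp

lemma sgT_mem (d : ℕ) : sgT d ∈ posQ d := by
  refine (posQ_closed d).mem_of_tendsto (f := iterT d) (b := Filter.atTop) ?_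
    (Filter.Eventually.of_forall (iterT_mem d))
  rw [tendsto_iff_norm_sub_tendsto_zero]
  refine squeeze_zero (g := fun n : ℕ => (2:ℝ) / (n + 2)) (fun _ => norm_nonneg _) (fun n => ?_) ?_
  · rw [ContinuousMap.norm_le _ (by positivity)]
    intro x
    obtain ⟨s, h1, h2, h3⟩ := iterT_real d x
    have hl : lamT d x / (d + 1) ≤ 1 := by
      rw [div_le_one (by positivity)]; linarith [lamT_le d x]
    obtain ⟨k1, k2, k3⟩ := iter_real _ (div_nonneg (lamT_nonneg d x) (by positivity)) hl s h1 h2 n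
    rw [ContinuousMap.sub_apply, h3]
    change ‖(s n : ℂ) - ((1 - Real.sqrt (lamT d x / (d + 1)) : ℝ) : ℂ)‖ ≤ _
    rw [← Complex.ofReal_sub, Complex.norm_real, Real.norm_eq_abs, abs_le]
    constructor <;> linarith
  · have h1 : Filter.Tendsto (fun n : ℕ => (n : ℝ) + 2) Filter.atTop Filter.atTop :=
      Filter.tendsto_atTop_add_const_right _ _ tendsto_natCast_atTop_atTop
    exact h1.const_div_atTop 2

noncomputable def psiT (d : ℕ) (t : ℝ) : C(UnitAddTorus (Fin d), ℂ) :=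
  ⟨fun x => ((Real.exp (-t * Real.sqrt (lamT d x)) : ℝ) : ℂ), by have := lamT_cont d; fun_prop⟩

lemma psiT_mem (d : ℕ) (t : ℝ) (ht : 0 ≤ t) : psiT d t ∈ posQ d := by
  set R := t * Real.sqrt (d + 1) with hR
  have hR0 : 0 ≤ R := by positivity
  let g : C(UnitAddTorus (Fin d), ℂ) := ⟨fun x => Complex.exp (((R : ℂ) • sgT d) x), by fun_prop⟩
  have hg : g ∈ posQ d := posQ_exp d _ g (posQ_smul d R hR0 _ (sgT_mem d)) (fun x => rfl)
  have : psiT d t = ((Real.exp (-R) : ℝ) : ℂ) • g := by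
    ext x
    change ((Real.exp (-t * Real.sqrt (lamT d x)) : ℝ) : ℂ) = ((Real.exp (-R) : ℝ) : ℂ) •
      Complex.exp ((R : ℂ) * ((1 - Real.sqrt (lamT d x / (d + 1)) : ℝ) : ℂ))
    rw [smul_eq_mul, ← Complex.ofReal_mul, ← Complex.ofReal_exp, ← Complex.ofReal_mul,
      ← Real.exp_add]
    congr 2
    rw [Real.sqrt_div (lamT_nonneg d x), hR]
    have : Real.sqrt ((d:ℝ) + 1) ≠ 0 := by positivity
    field_simp
    ring
  rw [this]
  exact posQ_smul d _ (Real.exp_pos _).le _ hg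

lemma lamT_coe (d : ℕ) (ξ : Fin d → ℝ) :
    lamT d (fun i => (ξ i : UnitAddCircle)) = ∑ k, Real.sin (Real.pi * ξ k) ^ 2 := by
  unfold lamT
  refine Finset.sum_congr rfl fun k _ => ?_
  rw [fourier_coe_apply]
  have : (2 * Real.pi * Complex.I * ((1 : ℤ) : ℂ) * (ξ k : ℂ) / ((1 : ℝ) : ℂ) : ℂ) =
      ((2 * (Real.pi * ξ k) : ℝ) : ℂ) * Complex.I := by
    push_cast; ring
  rw [this, Complex.exp_ofReal_mul_I_re, Real.sin_sq_eq_half_sub]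
  ring

lemma mFourier_coe (d : ℕ) (z : Fin d → ℤ) (ξ : Fin d → ℝ) :
    mFourier z (fun i => (ξ i : UnitAddCircle)) =
      Complex.exp (2 * Real.pi * Complex.I * ∑ k, (z k : ℂ) * (ξ k : ℂ)) := by
  change ∏ i, fourier (z i) (ξ i : UnitAddCircle) = _
  simp only [fourier_coe_apply]
  rw [← Complex.exp_sum, Finset.mul_sum]
  congr 1
  refine Finset.sum_congr rfl fun k _ => ?_
  simp; ring

lemma coeff_psiT (d : ℕ) (t : ℝ) (z : Fin d → ℤ) : coeffL d z (psiT d t) = poissonKer d t z := by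
  rw [coeffL_eq, mFourierCoeff_eq_integral _ _ (fun _ => -(1/2 : ℝ)), poissonKer]
  have hset : {x : Fin d → ℝ | ∀ i, x i ∈ Set.Ioc (-(1/2 : ℝ)) (-(1/2) + 1)} =
      Set.univ.pi (fun _ : Fin d => Set.Ioc (-(1/2 : ℝ)) (1/2)) := by
    ext x; norm_num [Set.mem_pi]
  rw [hset]
  have hae : (Set.univ.pi (fun _ : Fin d => Set.Ioc (-(1/2 : ℝ)) (1/2)) : Set (Fin d → ℝ))
      =ᵐ[volume] Set.Icc (fun _ => -(1 / 2 : ℝ)) (fun _ => (1 / 2 : ℝ)) :=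
    Measure.univ_pi_Ioc_ae_eq_Icc
  rw [setIntegral_congr_set hae]
  congr 1
  funext ξ
  rw [mFourier_coe]
  change _ * ((Real.exp (-t * Real.sqrt (lamT d fun i => (ξ i : UnitAddCircle))) : ℝ) : ℂ) = _
  rw [lamT_coe, Complex.ofReal_exp, ← Complex.exp_add]
  congr 1
  simp only [sinNorm, Pi.neg_apply]
  push_cast
  simp only [neg_mul, Finset.sum_neg_distrib]
  ring

lemma coeff_conj (d : ℕ) (t : ℝ) (z : Fin d → ℤ) :
    coeffL d (-z) (psiT d t) = (starRingEnd ℂ) (coeffL d z (psiT d t)) := by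
  rw [coeffL_eq, coeffL_eq]
  unfold mFourierCoeff
  rw [← integral_conj]
  congr 1
  funext x
  simp only [smul_eq_mul, map_mul, ← mFourier_neg]
  congr 1
  change _ = (starRingEnd ℂ) ((_ : ℝ) : ℂ)
  rw [Complex.conj_ofReal]; rfl

theorem kernel_exists (d : ℕ) : ∃ k : ℝ → (Fin d → ℤ) → ℝ≥0∞,
    (∀ t, 0 ≤ t → ∀ z, k t z ≠ ∞ ∧ poissonKer d t z = ((k t z).toReal : ℂ)) ∧
    (∀ t, 0 ≤ t → ∀ z, k t (-z) = k t z) ∧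
    (∀ t, 0 ≤ t → ∑' z, k t z = 1) ∧
    (∀ s t, 0 ≤ s → 0 ≤ t → ∀ z, k (s + t) z = ∑' w, k s w * k t (z - w)) := by
  let c : ℝ → (Fin d → ℤ) → ℝ := fun t z => (coeffL d z (psiT d t)).re
  have hc0 : ∀ t, 0 ≤ t → ∀ z, 0 ≤ c t z := fun t ht z => (posQ_coeff d z _ (psiT_mem d t ht)).1
  have hcc : ∀ t, 0 ≤ t → ∀ z, coeffL d z (psiT d t) = (c t z : ℂ) := fun t ht z =>
    Complex.ext rfl (by simp [(posQ_coeff d z _ (psiT_mem d t ht)).2])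
  have hsum : ∀ t, 0 ≤ t → Summable (c t) := fun t ht =>
    summable_of_sum_le (hc0 t ht) (fun s => posQ_sum d s _ (psiT_mem d t ht))
  have hinv : ∀ t, 0 ≤ t → HasSum (fun z => (c t z : ℂ) • (mFourier z : C(UnitAddTorus (Fin d), ℂ)))
      (psiT d t) := by
    intro t ht
    have : Summable (mFourierCoeff (psiT d t)) := by
      have h2 : mFourierCoeff (psiT d t) = fun z => (c t z : ℂ) := by
        funext z; rw [← coeffL_eq, hcc t ht]
      rw [h2]; exact Complex.summable_ofReal.2 (hsum t ht)
    have h3 := hasSum_mFourier_series_of_summable this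
    simp only [← coeffL_eq, hcc t ht] at h3
    exact h3
  have hone : ∀ t, 0 ≤ t → HasSum (c t) 1 := by
    intro t ht
    have := (ContinuousMap.evalCLM ℂ (0 : UnitAddTorus (Fin d))).hasSum (hinv t ht)
    have h0 : ∀ w, (mFourier w : C(UnitAddTorus (Fin d), ℂ)) 0 = 1 := by
      intro w; simp [mFourier]
    have h1 : psiT d t 0 = 1 := by
      change ((Real.exp (-t * Real.sqrt (lamT d 0)) : ℝ) : ℂ) = 1
      have : lamT d 0 = 0 := by simp [lamT]
      rw [this]; simp
    rw [← Complex.hasSum_ofReal]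
    have h2 : HasSum (fun z => (c t z : ℂ) • (mFourier z : C(UnitAddTorus (Fin d), ℂ)) 0)
      (psiT d t 0) := this
    simpa [h0, h1] using h2
  have hsemi : ∀ s t, 0 ≤ s → 0 ≤ t → ∀ z, HasSum (fun w => c s w * c t (z - w)) (c (s + t) z) := by
    intro s t hs ht z
    have hmul : psiT d (s + t) = psiT d s * psiT d t := by
      ext x
      change ((Real.exp (-(s + t) * Real.sqrt (lamT d x)) : ℝ) : ℂ) =
        ((Real.exp (-s * Real.sqrt (lamT d x)) : ℝ) : ℂ) *
        ((Real.exp (-t * Real.sqrt (lamT d x)) : ℝ) : ℂ)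
      rw [← Complex.ofReal_mul, ← Real.exp_add]
      congr 2; ring
    have h1 := (coeffL d z).hasSum ((hinv s hs).mul_right (psiT d t))
    rw [← hmul, hcc (s + t) (add_nonneg hs ht)] at h1
    rw [← Complex.hasSum_ofReal]
    convert h1 using 2 with w
    rw [smul_mul_assoc, map_smul, coeffL_mul_mFourier, hcc t ht]
    simp
  refine ⟨fun t z => ENNReal.ofReal (c t z), ?_, ?_, ?_, ?_⟩
  · intro t ht z
    refine ⟨ENNReal.ofReal_ne_top, ?_⟩
    rw [ENNReal.toReal_ofReal (hc0 t ht z), ← coeff_psiT, hcc t ht]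
  · intro t ht z
    have := coeff_conj d t z
    rw [hcc t ht, hcc t ht, Complex.conj_ofReal] at this
    change ENNReal.ofReal (c t (-z)) = ENNReal.ofReal (c t z)
    rw [Complex.ofReal_inj.1 this]
  · intro t ht
    rw [← ENNReal.ofReal_tsum_of_nonneg (hc0 t ht) (hsum t ht), (hone t ht).tsum_eq]
    simp
  · intro s t hs ht z
    have := hsemi s t hs ht z
    simp only [← ENNReal.ofReal_mul (hc0 s hs _)]
    rw [← ENNReal.ofReal_tsum_of_nonneg (fun w => mul_nonneg (hc0 s hs _) (hc0 t ht _))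
      this.summable, this.tsum_eq]
end KernelSec
/-- Nazarov–Treil type Bellman function. -/
noncomputable def bell (m : ℝ) (u v : ℝ) : ℝ :=
  7 * m ^ 2 * u ^ (m + 1) + 7 * m ^ 2 * v ^ (1 + 1 / m) + u ^ 2 * (v + u ^ m) ^ (1 - 1 / m)

lemma bell_quad (r m σ K1 K2 U V W e g M N a b : ℝ) (hr0 : 0 ≤ r) (hr1 : r ≤ 1)
    (hσ : σ = 1 ∨ σ = -1) (hU : 0 ≤ U) (hV : 0 < V) (hW : 0 ≤ W)
    (he : 0 ≤ e) (hg : 0 ≤ g) (hM : 0 ≤ M) (hN : 0 ≤ N) (heg : e ^ 2 = g * W)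
    (h1 : g * M ^ 2 ≤ m ^ 2 * U) (h2 : g ≤ V) (h3 : 1 ≤ W * V) (hK1 : 2 * m ^ 2 ≤ K1)
    (hK2 : 7 ≤ K2) :
    0 ≤ K1 * U * a ^ 2 + K2 * V * b ^ 2 + 2 * a ^ 2 * W + 4 * r * e * a * (b + M * a)
      - r * (1 - r) * g * (b + M * a) ^ 2 + N * a ^ 2 + 2 * σ * a * b := by
  have k1 : r * (1 - r) * g * (b + M * a) ^ 2 ≤ 2 * V * b ^ 2 + 2 * m ^ 2 * U * a ^ 2 := by
    have : r * (1 - r) ≤ 1 := by nlinarith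
    have h4 : (b + M * a) ^ 2 ≤ 2 * b ^ 2 + 2 * M ^ 2 * a ^ 2 := by
      nlinarith [sq_nonneg (b - M * a)]
    calc r * (1 - r) * g * (b + M * a) ^ 2 = (r * (1 - r)) * (g * (b + M * a) ^ 2) := by ring
      _ ≤ 1 * (g * (b + M * a) ^ 2) := by gcongr
      _ ≤ g * (2 * b ^ 2 + 2 * M ^ 2 * a ^ 2) := by rw [one_mul]; gcongr
      _ = 2 * g * b ^ 2 + 2 * (g * M ^ 2) * a ^ 2 := by ring
      _ ≤ 2 * V * b ^ 2 + 2 * (m ^ 2 * U) * a ^ 2 := by gcongr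
      _ = _ := by ring
  have k2 : 0 ≤ 4 * r * e * a * b + a ^ 2 * W + 4 * V * b ^ 2 := by
    have h5 : (r * e) ^ 2 ≤ V * W := by
      have : r ^ 2 ≤ 1 := by nlinarith
      calc (r * e) ^ 2 = r ^ 2 * (g * W) := by rw [mul_pow, heg]
        _ ≤ 1 * (V * W) := by gcongr
        _ = _ := one_mul _
    rcases hW.eq_or_lt with h | h
    · subst h; simp at h3; linarith
    · have : 0 ≤ W * (4 * r * e * a * b + a ^ 2 * W + 4 * V * b ^ 2) := by
        nlinarith [sq_nonneg (W * a + 2 * (r * e) * b), sq_nonneg b]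
      exact nonneg_of_mul_nonneg_right this h
  have k3 : 0 ≤ a ^ 2 * W + V * b ^ 2 + 2 * σ * a * b := by
    have : 0 ≤ V * (a ^ 2 * W + V * b ^ 2 + 2 * σ * a * b) := by
      have hs : σ ^ 2 = 1 := by rcases hσ with h | h <;> rw [h] <;> norm_num
      nlinarith [sq_nonneg (V * b + σ * a), sq_nonneg a]
    exact nonneg_of_mul_nonneg_right this hV
  have k4 : 0 ≤ 4 * r * e * M * a ^ 2 := by positivity
  have k5 : 2 * m ^ 2 * U * a ^ 2 ≤ K1 * U * a ^ 2 := by gcongr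
  have k6 : 7 * V * b ^ 2 ≤ K2 * V * b ^ 2 := by gcongr
  have k7 : 0 ≤ N * a ^ 2 := by positivity
  nlinarith

lemma bell_facts (m u v : ℝ) (hm : 1 ≤ m) (hu : 0 < u) (hv : 0 < v) :
    let w := v + u ^ m
    let r := 1 - 1 / m
    (u * w ^ (r - 1)) ^ 2 = (u ^ 2 * w ^ (r - 2)) * w ^ r ∧
    (u ^ 2 * w ^ (r - 2)) * (m * u ^ (m - 1)) ^ 2 ≤ m ^ 2 * u ^ (m - 1) ∧
    u ^ 2 * w ^ (r - 2) ≤ v ^ (-r) ∧ 1 ≤ w ^ r * v ^ (-r) := by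
  intro w r
  have hm0 : 0 < m := by linarith
  have hum : 0 < u ^ m := Real.rpow_pos_of_pos hu _
  have hw : 0 < w := by positivity
  have huw : u ^ m ≤ w := by simp only [w]; linarith
  have hvw : v ≤ w := by simp only [w]; linarith
  have hr0 : 0 ≤ r := by
    simp only [r]; rw [sub_nonneg, div_le_one hm0]; exact hm
  have hr1 : r ≤ 1 := by simp only [r]; have : 0 < 1 / m := by positivity
                         linarith
  refine ⟨?_, ?_, ?_, ?_⟩
  · rw [mul_pow, mul_assoc, ← Real.rpow_add hw, ← Real.rpow_natCast (w ^ (r - 1)),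
      ← Real.rpow_mul hw.le]
    congr 2; push_cast; ring
  · have h1 : w ^ (r - 2) ≤ (u ^ m) ^ (r - 2) :=
      Real.rpow_le_rpow_of_nonpos hum huw (by linarith)
    rw [← Real.rpow_mul hu.le] at h1
    calc (u ^ 2 * w ^ (r - 2)) * (m * u ^ (m - 1)) ^ 2
        ≤ (u ^ 2 * u ^ (m * (r - 2))) * (m * u ^ (m - 1)) ^ 2 := by gcongr
      _ = m ^ 2 * (u ^ (2:ℝ) * u ^ (m * (r - 2)) * u ^ (2 * (m - 1))) := by
        rw [mul_pow, ← Real.rpow_natCast (u ^ (m - 1)), ← Real.rpow_mul hu.le,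
          mul_comm (m - 1), Real.rpow_two]
        push_cast; ring
      _ = m ^ 2 * u ^ (m - 1) := by
        rw [← Real.rpow_add hu, ← Real.rpow_add hu]
        congr 2
        simp only [r]; field_simp; ring
  · have h1 : u ^ 2 ≤ w ^ (2 / m) := by
      calc u ^ 2 = (u ^ m) ^ (2 / m) := by
            rw [← Real.rpow_mul hu.le, mul_div_cancel₀ _ hm0.ne', Real.rpow_two]
        _ ≤ w ^ (2 / m) := by gcongr
    calc u ^ 2 * w ^ (r - 2) ≤ w ^ (2 / m) * w ^ (r - 2) := by gcongr
      _ = w ^ (-r) := by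
        rw [← Real.rpow_add hw]; congr 1; simp only [r]; field_simp; ring
      _ ≤ v ^ (-r) := Real.rpow_le_rpow_of_nonpos hv hvw (by linarith)
  · rw [Real.rpow_neg hv.le, ← div_eq_mul_inv, one_le_div (Real.rpow_pos_of_pos hv _)]
    gcongr

lemma bell_line (m σ : ℝ) (hm : 1 ≤ m) (hσ : σ = 1 ∨ σ = -1) (u0 v0 u1 v1 : ℝ)
    (hu0 : 0 < u0) (hv0 : 0 < v0) (hu1 : 0 < u1) (hv1 : 0 < v1) :
    ConvexOn ℝ (Set.Icc (0:ℝ) 1) (fun t => bell m (u0 + t * (u1 - u0)) (v0 + t * (v1 - v0)) +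
      σ * ((u0 + t * (u1 - u0)) * (v0 + t * (v1 - v0)))) := by
  have hm0 : 0 < m := by linarith
  set a := u1 - u0 with ha
  set b := v1 - v0 with hb
  have hu : ∀ t ∈ Set.Icc (0:ℝ) 1, 0 < u0 + t * a := by
    intro t ht
    rcases ht.2.eq_or_lt with h | h
    · rw [h, ha]; linarith
    · have : u0 + t * a = (1 - t) * u0 + t * u1 := by rw [ha]; ring
      rw [this]; have := mul_pos (sub_pos.2 h) hu0; have := mul_nonneg ht.1 hu1.le; linarith
  have hv : ∀ t ∈ Set.Icc (0:ℝ) 1, 0 < v0 + t * b := by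
    intro t ht
    rcases ht.2.eq_or_lt with h | h
    · rw [h, hb]; linarith
    · have : v0 + t * b = (1 - t) * v0 + t * v1 := by rw [hb]; ring
      rw [this]; have := mul_pos (sub_pos.2 h) hv0; have := mul_nonneg ht.1 hv1.le; linarith
  let u : ℝ → ℝ := fun t => u0 + t * a
  let v : ℝ → ℝ := fun t => v0 + t * b
  let r := 1 - 1 / m
  let w : ℝ → ℝ := fun t => v t + u t ^ m
  let w' : ℝ → ℝ := fun t => b + m * u t ^ (m - 1) * a
  have du : ∀ t, HasDerivAt u a t := fun t => by
    exact (((hasDerivAt_id t).mul_const a).const_add u0).congr_deriv (one_mul a)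
  have dv : ∀ t, HasDerivAt v b t := fun t => by
    exact (((hasDerivAt_id t).mul_const b).const_add v0).congr_deriv (one_mul b)
  have dw : ∀ t, 0 < u t → HasDerivAt w (w' t) t := fun t h => by
    refine ((dv t).add ((du t).rpow_const (p := m) (Or.inl h.ne'))).congr_deriv ?_
    simp only [w']; ring
  have dw' : ∀ t, 0 < u t → HasDerivAt w' (m * (m - 1) * u t ^ (m - 2) * a ^ 2) t := fun t h => by
    refine ((((du t).rpow_const (p := m - 1) (Or.inl h.ne')).const_mul m |>.mul_const a).const_add
      b).congr_deriv ?_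
    rw [show m - 1 - 1 = m - 2 by ring]; ring
  have hwpos : ∀ t, 0 < u t → 0 < v t → 0 < w t := fun t h1 h2 => by
    have := Real.rpow_pos_of_pos h1 m
    simp only [w]; linarith
  let F : ℝ → ℝ := fun t => 7 * m ^ 2 * u t ^ (m + 1) + 7 * m ^ 2 * v t ^ (1 + 1 / m) +
    u t ^ 2 * w t ^ r + σ * (u t * v t)
  let F' : ℝ → ℝ := fun t => 7 * m ^ 2 * (m + 1) * u t ^ m * a +
    7 * m ^ 2 * (1 + 1 / m) * v t ^ (1 / m) * b +
    (2 * a * u t * w t ^ r + r * (u t ^ 2 * w t ^ (r - 1) * w' t)) + σ * (a * v t + u t * b)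
  let F'' : ℝ → ℝ := fun t => (7 * m ^ 2 * (m + 1) * m) * u t ^ (m - 1) * a ^ 2 +
    (7 * m ^ 2 * (1 + 1 / m) * (1 / m)) * v t ^ (-r) * b ^ 2 +
    2 * a ^ 2 * w t ^ r + 4 * r * (u t * w t ^ (r - 1)) * a * (b + m * u t ^ (m - 1) * a)
    - r * (1 - r) * (u t ^ 2 * w t ^ (r - 2)) * (b + m * u t ^ (m - 1) * a) ^ 2
    + (r * u t ^ 2 * w t ^ (r - 1) * (m * (m - 1) * u t ^ (m - 2))) * a ^ 2 + 2 * σ * a * b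
  have dF : ∀ t ∈ Set.Icc (0:ℝ) 1, HasDerivAt F (F' t) t := by
    intro t ht
    have h1 := hu t ht
    have h2 := hv t ht
    change 0 < u t at h1
    change 0 < v t at h2
    have h3 := hwpos t h1 h2
    refine ((((((du t).rpow_const (p := m + 1) (Or.inl h1.ne')).const_mul (7 * m ^ 2)).add
      (((dv t).rpow_const (p := 1 + 1 / m) (Or.inl h2.ne')).const_mul (7 * m ^ 2))).add
      (((du t).pow 2).mul ((dw t h1).rpow_const (p := r) (Or.inl h3.ne')))).add
      (((du t).mul (dv t)).const_mul σ)).congr_deriv ?_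
    simp only [F', Pi.pow_apply]
    rw [show m + 1 - 1 = m by ring, show 1 + 1 / m - 1 = 1 / m by ring]
    push_cast
    ring
  have dF' : ∀ t ∈ Set.Icc (0:ℝ) 1, HasDerivAt F' (F'' t) t := by
    intro t ht
    have h1 := hu t ht
    have h2 := hv t ht
    change 0 < u t at h1
    change 0 < v t at h2
    have h3 := hwpos t h1 h2
    have e1 := ((du t).rpow_const (p := m) (Or.inl h1.ne')).const_mul (7 * m ^ 2 * (m + 1))
      |>.mul_const a
    have e2 := ((dv t).rpow_const (p := 1 / m) (Or.inl h2.ne')).const_mul (7 * m ^ 2 * (1 + 1 / m))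
      |>.mul_const b
    have e3 := ((du t).const_mul (2 * a)).mul ((dw t h1).rpow_const (p := r) (Or.inl h3.ne'))
    have e4 := ((((du t).pow 2).mul ((dw t h1).rpow_const (p := r - 1) (Or.inl h3.ne'))).mul
      (dw' t h1)).const_mul r
    have e5 := (((dv t).const_mul a).add ((du t).mul_const b)).const_mul σ
    refine ((((e1.add e2).add (e3.add e4)).add e5)).congr_deriv ?_
    simp only [F'', Pi.pow_apply, Pi.mul_apply]
    rw [show r - 1 - 1 = r - 2 by ring, show 1 / m - 1 = -r by simp only [r]; ring]
    simp only [w']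
    push_cast
    ring
  have hFF : (fun t => bell m (u0 + t * a) (v0 + t * b) +
      σ * ((u0 + t * a) * (v0 + t * b))) = F := by
    funext t; simp only [bell, F, u, v, w, r]
  rw [hFF]
  refine convexOn_of_hasDerivWithinAt2_nonneg (convex_Icc 0 1) (f' := F') (f'' := F'')
    (fun t ht => (dF t ht).continuousAt.continuousWithinAt)
    (fun t ht => (dF t (interior_subset ht)).hasDerivWithinAt)
    (fun t ht => (dF' t (interior_subset ht)).hasDerivWithinAt) ?_
  intro t ht
  have h1 := hu t (interior_subset ht)
  have h2 := hv t (interior_subset ht)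
  change 0 < u t at h1
  change 0 < v t at h2
  have h3 := hwpos t h1 h2
  obtain ⟨f1, f2, f3, f4⟩ := bell_facts m (u t) (v t) hm h1 h2
  have hr0 : 0 ≤ r := by
    simp only [r]; rw [sub_nonneg, div_le_one hm0]; exact hm
  have hr1 : r ≤ 1 := by simp only [r]; have : 0 < 1 / m := by positivity
                         linarith
  have hm1 : 0 ≤ m - 1 := by linarith
  refine bell_quad r m σ _ _ _ _ _ _ _ _ _ a b hr0 hr1 hσ (by positivity) (by positivity)
    (by positivity) (by positivity) (by positivity) (by positivity) (by positivity) f1 f2 f3 f4 ?_ ?_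
  · nlinarith [mul_nonneg hm0.le hm1, sq_nonneg m, mul_nonneg (sq_nonneg m) (mul_nonneg hm0.le hm1)]
  · have : 7 * m ^ 2 * (1 + 1 / m) * (1 / m) = 7 * (m + 1) := by field_simp
    rw [this]; linarith

lemma bell_continuous (m : ℝ) (hm : 1 ≤ m) : Continuous (fun z : ℝ × ℝ => bell m z.1 z.2) := by
  have hm0 : 0 < m := by linarith
  have hr0 : 0 ≤ 1 - 1 / m := by
    rw [sub_nonneg, div_le_one hm0]; exact hm
  unfold bell
  have h1 : Continuous (fun z : ℝ × ℝ => z.1 ^ (m + 1)) :=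
    continuous_fst.rpow_const (fun _ => Or.inr (by linarith))
  have h2 : Continuous (fun z : ℝ × ℝ => z.2 ^ (1 + 1 / m)) :=
    continuous_snd.rpow_const (fun _ => Or.inr (by positivity))
  have h3 : Continuous (fun z : ℝ × ℝ => z.1 ^ m) :=
    continuous_fst.rpow_const (fun _ => Or.inr (by linarith))
  have h4 : Continuous (fun z : ℝ × ℝ => (z.2 + z.1 ^ m) ^ (1 - 1 / m)) :=
    (continuous_snd.add h3).rpow_const (fun _ => Or.inr hr0)
  fun_prop

lemma bell_convex (m σ : ℝ) (hm : 1 ≤ m) (hσ : σ = 1 ∨ σ = -1) :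
    ConvexOn ℝ (Set.Ici (0 : ℝ × ℝ)) (fun z => bell m z.1 z.2 + σ * (z.1 * z.2)) := by
  refine ⟨convex_Ici _, ?_⟩
  intro x hx y hy s t hs ht hst
  have hx' : 0 ≤ x.1 ∧ 0 ≤ x.2 := hx
  have hy' : 0 ≤ y.1 ∧ 0 ≤ y.2 := hy
  set H : ℝ × ℝ → ℝ := fun z => bell m z.1 z.2 + σ * (z.1 * z.2) with hH
  have hc : Continuous H := (bell_continuous m hm).add (by fun_prop)
  have key : ∀ ε > 0, H (s • x + t • y + (ε, ε)) ≤ s • H (x + (ε, ε)) + t • H (y + (ε, ε)) := by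
    intro ε hε
    have := (bell_line m σ hm hσ (x.1 + ε) (x.2 + ε) (y.1 + ε) (y.2 + ε) (by linarith) (by linarith)
      (by linarith) (by linarith)).2 (x := 0) (by simp) (y := 1) (by simp) hs ht hst
    simp only [smul_eq_mul, mul_zero, mul_one, zero_add, zero_mul, add_zero, one_mul,
      add_sub_cancel] at this
    simp only [hH, Prod.fst_add, Prod.snd_add, Prod.smul_fst, Prod.smul_snd, smul_eq_mul]
    have hs' : s = 1 - t := by linarith
    have e1 : s * x.1 + t * y.1 + ε = x.1 + ε + t * (y.1 + ε - (x.1 + ε)) := by rw [hs']; ring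
    have e2 : s * x.2 + t * y.2 + ε = x.2 + ε + t * (y.2 + ε - (x.2 + ε)) := by rw [hs']; ring
    rw [e1, e2]; exact this
  have hl : ∀ z : ℝ × ℝ, Filter.Tendsto (fun ε : ℝ => H (z + (ε, ε))) (nhdsWithin 0 (Set.Ioi 0))
      (nhds (H z)) := by
    intro z
    have : Continuous (fun ε : ℝ => H (z + (ε, ε))) := by fun_prop
    have h2 := this.tendsto 0
    simp only [Prod.mk_zero_zero, add_zero] at h2
    exact h2.mono_left nhdsWithin_le_nhds
  refine le_of_tendsto_of_tendsto (hl _) (((hl x).const_smul s).add ((hl y).const_smul t)) ?_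
  filter_upwards [self_mem_nhdsWithin] with ε hε using key ε hε

lemma bell_upper (m u v : ℝ) (hm : 1 ≤ m) (hu : 0 ≤ u) (hv : 0 ≤ v) :
    bell m u v ≤ (7 * m ^ 2 + 2) * (u ^ (m + 1) + v ^ (1 + 1 / m)) := by
  have hm0 : 0 < m := by linarith
  have hr0 : 0 ≤ 1 - 1 / m := by
    rw [sub_nonneg, div_le_one hm0]; exact hm
  have hr1 : 1 - 1 / m ≤ 1 := by
    have : 0 < 1 / m := by positivity
    linarith
  have h2r : (2:ℝ) ^ (1 - 1 / m) ≤ 2 := by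
    calc (2:ℝ) ^ (1 - 1 / m) ≤ 2 ^ (1:ℝ) := Real.rpow_le_rpow_of_exponent_le (by norm_num) hr1
      _ = 2 := by simp
  have p1 : 0 ≤ u ^ (m + 1) := by positivity
  have p2 : 0 ≤ v ^ (1 + 1 / m) := by positivity
  have p3 : 0 ≤ u ^ m := by positivity
  suffices u ^ 2 * (v + u ^ m) ^ (1 - 1 / m) ≤ 2 * (u ^ (m + 1) + v ^ (1 + 1 / m)) by
    unfold bell; linarith
  rcases le_total (u ^ m) v with h | h
  · have h1 : u ^ 2 ≤ v ^ (2 / m) := by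
      calc u ^ 2 = (u ^ m) ^ (2 / m) := by
            rw [← Real.rpow_mul hu, mul_div_cancel₀ _ hm0.ne', Real.rpow_two]
        _ ≤ v ^ (2 / m) := by gcongr
    calc u ^ 2 * (v + u ^ m) ^ (1 - 1 / m) ≤ v ^ (2 / m) * (2 * v) ^ (1 - 1 / m) := by
          gcongr; linarith
      _ = 2 ^ (1 - 1 / m) * (v ^ (2 / m) * v ^ (1 - 1 / m)) := by
          rw [Real.mul_rpow (by norm_num) hv]; ring
      _ = 2 ^ (1 - 1 / m) * v ^ (1 + 1 / m) := by
          rw [← Real.rpow_add_of_nonneg hv (by positivity) hr0]; congr 2; ring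
      _ ≤ 2 * v ^ (1 + 1 / m) := by gcongr
      _ ≤ _ := by linarith
  · calc u ^ 2 * (v + u ^ m) ^ (1 - 1 / m) ≤ u ^ 2 * (2 * u ^ m) ^ (1 - 1 / m) := by
          gcongr; linarith
      _ = 2 ^ (1 - 1 / m) * (u ^ (2:ℝ) * u ^ (m * (1 - 1 / m))) := by
          rw [Real.mul_rpow (by norm_num) p3, ← Real.rpow_mul hu, Real.rpow_two]; ring
      _ = 2 ^ (1 - 1 / m) * u ^ (m + 1) := by
          rw [← Real.rpow_add_of_nonneg hu (by positivity) (by positivity)]; congr 2; field_simp; ring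
      _ ≤ 2 * u ^ (m + 1) := by gcongr
      _ ≤ _ := by linarith

lemma young_m (m u v : ℝ) (hm : 1 ≤ m) (hu : 0 ≤ u) (hv : 0 ≤ v) :
    u * v ≤ u ^ (m + 1) + v ^ (1 + 1 / m) := by
  have hm0 : 0 < m := by linarith
  have hc : (m + 1).HolderConjugate (1 + 1 / m) := by
    rw [Real.holderConjugate_iff]; refine ⟨by linarith, ?_⟩
    field_simp; ring
  have := Real.young_inequality_of_nonneg hu hv hc
  have p1 : 0 ≤ u ^ (m + 1) := by positivity
  have p2 : 0 ≤ v ^ (1 + 1 / m) := by positivity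
  have q1 : u ^ (m + 1) / (m + 1) ≤ u ^ (m + 1) := div_le_self p1 (by linarith)
  have q2 : v ^ (1 + 1 / m) / (1 + 1 / m) ≤ v ^ (1 + 1 / m) :=
    div_le_self p2 (by have : 0 < 1 / m := by positivity
                       linarith)
  linarith

lemma bell_lower (m u v : ℝ) (hm : 1 ≤ m) (hu : 0 ≤ u) (hv : 0 ≤ v) :
    u * v ≤ bell m u v := by
  have := young_m m u v hm hu hv
  have p1 : 0 ≤ u ^ (m + 1) := by positivity
  have p2 : 0 ≤ v ^ (1 + 1 / m) := by positivity
  have p3 : 0 ≤ u ^ 2 * (v + u ^ m) ^ (1 - 1 / m) := by positivity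
  have : 1 ≤ 7 * m ^ 2 := by nlinarith
  unfold bell
  nlinarith

section Abstract
variable {G : Type*} [AddCommGroup G]

/-- convolution in `ℝ≥0∞` -/
noncomputable def PP (k : G → ℝ≥0∞) (f : G → ℝ≥0∞) (x : G) : ℝ≥0∞ := ∑' y, k (x - y) * f y

lemma PP_sum (k f : G → ℝ≥0∞) (hk : ∑' z, k z = 1) : ∑' x, PP k f x = ∑' x, f x := by
  unfold PP
  rw [ENNReal.tsum_comm]
  refine tsum_congr fun y => ?_
  rw [ENNReal.tsum_mul_right]
  have : ∑' x, k (x - y) = ∑' z, k z := (Equiv.subRight y).tsum_eq k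
  rw [this, hk, one_mul]

lemma PP_row (k : G → ℝ≥0∞) (hk : ∑' z, k z = 1) (x : G) : ∑' y, k (x - y) = 1 := by
  have : ∑' y, k (x - y) = ∑' z, k z := (Equiv.subLeft x).tsum_eq k
  rw [this, hk]

lemma PP_comp (k1 k2 k3 f : G → ℝ≥0∞) (h : ∀ z, k3 z = ∑' w, k1 w * k2 (z - w)) (x : G) :
    PP k3 f x = PP k2 (PP k1 f) x := by
  unfold PP
  simp only [← ENNReal.tsum_mul_left]
  rw [ENNReal.tsum_comm]
  refine tsum_congr fun w => ?_
  rw [h, ← ENNReal.tsum_mul_right]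
  rw [← (Equiv.subRight w).tsum_eq]
  refine tsum_congr fun y => ?_
  simp only [Equiv.subRight_apply]
  rw [show x - w - (y - w) = x - y by abel]
  ring

lemma PP_symm (k f g : G → ℝ≥0∞) (h : ∀ z, k (-z) = k z) :
    ∑' x, PP k f x * g x = ∑' x, f x * PP k g x := by
  unfold PP
  simp only [← ENNReal.tsum_mul_left, ← ENNReal.tsum_mul_right]
  rw [ENNReal.tsum_comm]
  refine tsum_congr fun x => tsum_congr fun y => ?_
  rw [show y - x = -(x - y) by abel, h]; ring

lemma PP_ne_top (k f : G → ℝ≥0∞) (hk : ∑' z, k z = 1) (p : ℝ) (hp : 1 ≤ p)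
    (hf : ∑' x, f x ^ p ≠ ∞) (x : G) : PP k f x ≠ ∞ := by
  have h1 : PP k f x ≤ 1 + ∑' y, f y ^ p := by
    calc PP k f x ≤ ∑' y, (k (x - y) + f y ^ p) := by
          refine ENNReal.tsum_le_tsum fun y => ?_
          have hk1 : k (x - y) ≤ 1 := hk ▸ ENNReal.le_tsum (x - y)
          rcases le_total (f y) 1 with h | h
          · calc k (x - y) * f y ≤ k (x - y) * 1 := by gcongr
              _ ≤ _ := by rw [mul_one]; exact le_self_add
          · calc k (x - y) * f y ≤ 1 * f y ^ p := by
                  gcongr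
                  calc f y = f y ^ (1:ℝ) := by simp
                    _ ≤ f y ^ p := ENNReal.rpow_le_rpow_of_exponent_le h hp
              _ ≤ _ := by rw [one_mul]; exact le_add_self
      _ = _ := by rw [ENNReal.tsum_add, PP_row k hk]
  exact ne_top_of_le_ne_top (ENNReal.add_ne_top.2 ⟨ENNReal.one_ne_top, hf⟩) h1

lemma PP_jensen [Countable G] (k F H : G → ℝ≥0∞) (hk : ∑' z, k z = 1) (Φ : ℝ × ℝ → ℝ)
    (hΦ : ConvexOn ℝ (Set.Ici (0 : ℝ × ℝ)) Φ) (hc : Continuous Φ)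
    (h0 : ∀ z ∈ Set.Ici (0 : ℝ × ℝ), 0 ≤ Φ z)
    (hF : ∀ x, F x ≠ ∞) (hH : ∀ x, H x ≠ ∞) (x : G) (hPF : PP k F x ≠ ∞) (hPH : PP k H x ≠ ∞) :
    ENNReal.ofReal (Φ ((PP k F x).toReal, (PP k H x).toReal)) ≤
      PP k (fun y => ENNReal.ofReal (Φ ((F y).toReal, (H y).toReal))) x := by
  by_cases htop : PP k (fun y => ENNReal.ofReal (Φ ((F y).toReal, (H y).toReal))) x = ∞
  · rw [htop]; exact le_top
  letI : MeasurableSpace G := ⊤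
  haveI : MeasurableSingletonClass G := ⟨fun _ => trivial⟩
  let P : PMF G := ⟨fun y => k (x - y), by
    have := PP_row k hk x
    rw [← this]; exact ENNReal.summable.hasSum⟩
  let μ := P.toMeasure
  haveI : IsProbabilityMeasure μ := inferInstanceAs (IsProbabilityMeasure P.toMeasure)
  have hlin : ∀ φ : G → ℝ≥0∞, ∫⁻ y, φ y ∂μ = PP k φ x := by
    intro φ
    rw [lintegral_countable']
    refine tsum_congr fun y => ?_
    rw [show μ {y} = k (x - y) from P.toMeasure_apply_singleton y (by trivial)]
    ring
  have hmeas : ∀ φ : G → ℝ≥0∞, Measurable φ := fun φ => measurable_from_top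
  have hint : ∀ φ : G → ℝ≥0∞, PP k φ x ≠ ∞ → Integrable (fun y => (φ y).toReal) μ := by
    intro φ hφ
    exact integrable_toReal_of_lintegral_ne_top (hmeas φ).aemeasurable (by rwa [hlin])
  have hval : ∀ φ : G → ℝ≥0∞, (∀ y, φ y ≠ ∞) → ∫ y, (φ y).toReal ∂μ = (PP k φ x).toReal := by
    intro φ hφ
    rw [integral_toReal (hmeas φ).aemeasurable (Filter.Eventually.of_forall fun y =>
      (hφ y).lt_top), hlin]
  have i1 := hint F hPF
  have i2 := hint H hPH
  have i3 := hint _ htop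
  have hmem : ∀ y, ((F y).toReal, (H y).toReal) ∈ Set.Ici (0 : ℝ × ℝ) := fun y =>
    ⟨ENNReal.toReal_nonneg, ENNReal.toReal_nonneg⟩
  have e3 : (fun y => (ENNReal.ofReal (Φ ((F y).toReal, (H y).toReal))).toReal) =
      fun y => Φ ((F y).toReal, (H y).toReal) := by
    funext y; exact ENNReal.toReal_ofReal (h0 _ (hmem y))
  have v3 := hval _ (fun y => ENNReal.ofReal_ne_top (r := Φ ((F y).toReal, (H y).toReal)))
  rw [e3] at i3 v3
  have J := hΦ.map_integral_le (μ := μ) (f := fun y => ((F y).toReal, (H y).toReal))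
    hc.continuousOn isClosed_Ici (Filter.Eventually.of_forall hmem) (i1.prodMk i2) i3
  rw [integral_pair i1 i2, hval F hF, hval H hH, v3] at J
  calc _ ≤ ENNReal.ofReal _ := ENNReal.ofReal_le_ofReal J
    _ = _ := ENNReal.ofReal_toReal htop

/-- Bellman energy -/
noncomputable def EE (m : ℝ) (F H : G → ℝ≥0∞) : ℝ≥0∞ :=
  ∑' x, ENNReal.ofReal (bell m (F x).toReal (H x).toReal)

lemma step_aux [Countable G] (m : ℝ) (hm : 1 ≤ m) (k F H : G → ℝ≥0∞) (hk : ∑' z, k z = 1)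
    (σ : ℝ) (hσ : σ = 1 ∨ σ = -1)
    (hF : ∀ x, F x ≠ ∞) (hH : ∀ x, H x ≠ ∞) (hPF : ∀ x, PP k F x ≠ ∞) (hPH : ∀ x, PP k H x ≠ ∞) :
    ∑' x, ENNReal.ofReal (bell m (PP k F x).toReal (PP k H x).toReal +
        σ * ((PP k F x).toReal * (PP k H x).toReal)) ≤
      ∑' x, ENNReal.ofReal (bell m (F x).toReal (H x).toReal +
        σ * ((F x).toReal * (H x).toReal)) := by
  have hpos : ∀ z ∈ Set.Ici (0 : ℝ × ℝ), 0 ≤ bell m z.1 z.2 + σ * (z.1 * z.2) := by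
    rintro z ⟨h1, h2⟩
    have h1 : 0 ≤ z.1 := h1
    have h2 : 0 ≤ z.2 := h2
    have := bell_lower m z.1 z.2 hm h1 h2
    have := mul_nonneg h1 h2
    rcases hσ with h | h <;> rw [h] <;> linarith
  refine le_trans ?_ (PP_sum k (fun x => ENNReal.ofReal (bell m (F x).toReal (H x).toReal +
        σ * ((F x).toReal * (H x).toReal))) hk).le
  refine ENNReal.tsum_le_tsum fun x => ?_
  exact PP_jensen k F H hk _ (bell_convex m σ hm hσ) ((bell_continuous m hm).add (by fun_prop))
    hpos hF hH x (hPF x) (hPH x)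

lemma EE_plus (m : ℝ) (hm : 1 ≤ m) (F H : G → ℝ≥0∞) (hF : ∀ x, F x ≠ ∞) (hH : ∀ x, H x ≠ ∞) :
    ∑' x, ENNReal.ofReal (bell m (F x).toReal (H x).toReal +
        1 * ((F x).toReal * (H x).toReal)) = EE m F H + ∑' x, F x * H x := by
  rw [EE, ← ENNReal.tsum_add]
  refine tsum_congr fun x => ?_
  have h1 : 0 ≤ (F x).toReal := ENNReal.toReal_nonneg
  have h2 : 0 ≤ (H x).toReal := ENNReal.toReal_nonneg
  have h3 := bell_lower m _ _ hm h1 h2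
  have h4 := mul_nonneg h1 h2
  rw [one_mul, ENNReal.ofReal_add (h4.trans h3) h4, ENNReal.ofReal_mul h1,
    ENNReal.ofReal_toReal (hF x), ENNReal.ofReal_toReal (hH x)]

lemma EE_minus (m : ℝ) (hm : 1 ≤ m) (F H : G → ℝ≥0∞) (hF : ∀ x, F x ≠ ∞) (hH : ∀ x, H x ≠ ∞) :
    ∑' x, ENNReal.ofReal (bell m (F x).toReal (H x).toReal +
        (-1) * ((F x).toReal * (H x).toReal)) + ∑' x, F x * H x = EE m F H := by
  rw [EE, ← ENNReal.tsum_add]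
  refine tsum_congr fun x => ?_
  have h1 : 0 ≤ (F x).toReal := ENNReal.toReal_nonneg
  have h2 : 0 ≤ (H x).toReal := ENNReal.toReal_nonneg
  have h3 := bell_lower m _ _ hm h1 h2
  have h4 := mul_nonneg h1 h2
  have e : F x * H x = ENNReal.ofReal ((F x).toReal * (H x).toReal) := by
    rw [ENNReal.ofReal_mul h1, ENNReal.ofReal_toReal (hF x), ENNReal.ofReal_toReal (hH x)]
  rw [e, ← ENNReal.ofReal_add (by linarith) h4]
  congr 1; ring

lemma step [Countable G] (m : ℝ) (hm : 1 ≤ m) (k F H : G → ℝ≥0∞) (hk : ∑' z, k z = 1)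
    (hF : ∀ x, F x ≠ ∞) (hH : ∀ x, H x ≠ ∞) (hPF : ∀ x, PP k F x ≠ ∞) (hPH : ∀ x, PP k H x ≠ ∞)
    (hE : EE m F H ≠ ∞) :
    EE m (PP k F) (PP k H) ≠ ∞ ∧
    |(∑' x, PP k F x * PP k H x).toReal - (∑' x, F x * H x).toReal| ≤
      (EE m F H).toReal - (EE m (PP k F) (PP k H)).toReal := by
  have s1 := step_aux m hm k F H hk 1 (Or.inl rfl) hF hH hPF hPH
  have s2 := step_aux m hm k F H hk (-1) (Or.inr rfl) hF hH hPF hPH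
  rw [EE_plus m hm F H hF hH, EE_plus m hm _ _ hPF hPH] at s1
  have q1 := EE_minus m hm F H hF hH
  have q2 := EE_minus m hm _ _ hPF hPH
  set A := ∑' x, ENNReal.ofReal (bell m (F x).toReal (H x).toReal +
        (-1) * ((F x).toReal * (H x).toReal))
  set A' := ∑' x, ENNReal.ofReal (bell m (PP k F x).toReal (PP k H x).toReal +
        (-1) * ((PP k F x).toReal * (PP k H x).toReal))
  set D := ∑' x, F x * H x
  set D' := ∑' x, PP k F x * PP k H x
  set E := EE m F H
  set E' := EE m (PP k F) (PP k H)
  have hA : A ≠ ∞ := ne_top_of_le_ne_top hE (q1 ▸ le_self_add)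
  have hD : D ≠ ∞ := ne_top_of_le_ne_top hE (q1 ▸ le_add_self)
  have hED : E + D ≠ ∞ := ENNReal.add_ne_top.2 ⟨hE, hD⟩
  have hE' : E' ≠ ∞ := ne_top_of_le_ne_top hED (le_self_add.trans s1)
  have hD' : D' ≠ ∞ := ne_top_of_le_ne_top hED (le_add_self.trans s1)
  have hA' : A' ≠ ∞ := ne_top_of_le_ne_top hA s2
  refine ⟨hE', ?_⟩
  have r1 := ENNReal.toReal_mono hED s1
  rw [ENNReal.toReal_add hE hD, ENNReal.toReal_add hE' hD'] at r1
  have r2 := ENNReal.toReal_mono hA s2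
  have r3 := congrArg ENNReal.toReal q1
  have r4 := congrArg ENNReal.toReal q2
  rw [ENNReal.toReal_add hA hD] at r3
  rw [ENNReal.toReal_add hA' hD'] at r4
  rw [abs_le]; constructor <;> linarith

lemma EE_le (m : ℝ) (hm : 1 ≤ m) (F H : G → ℝ≥0∞) (hF : ∀ x, F x ≠ ∞) (hH : ∀ x, H x ≠ ∞) :
    EE m F H ≤ ENNReal.ofReal (7 * m ^ 2 + 2) *
      (∑' x, F x ^ (m + 1) + ∑' x, H x ^ (1 + 1 / m)) := by
  have hm0 : 0 < m := by linarith
  rw [EE, ← ENNReal.tsum_add, ← ENNReal.tsum_mul_left]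
  refine ENNReal.tsum_le_tsum fun x => ?_
  have h1 : 0 ≤ (F x).toReal := ENNReal.toReal_nonneg
  have h2 : 0 ≤ (H x).toReal := ENNReal.toReal_nonneg
  calc _ ≤ ENNReal.ofReal _ := ENNReal.ofReal_le_ofReal (bell_upper m _ _ hm h1 h2)
    _ = _ := by
      rw [ENNReal.ofReal_mul (by positivity), ENNReal.ofReal_add (p := (F x).toReal ^ (m + 1)) (by positivity) (by positivity),
        ← ENNReal.ofReal_rpow_of_nonneg h1 (by positivity),
        ← ENNReal.ofReal_rpow_of_nonneg h2 (by positivity),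
        ENNReal.ofReal_toReal (hF x), ENNReal.ofReal_toReal (hH x)]

/-- symmetric Markov convolution semigroup -/
structure MarkovK (k : ℝ → G → ℝ≥0∞) : Prop where
  symm : ∀ t, 0 ≤ t → ∀ z, k t (-z) = k t z
  one : ∀ t, 0 ≤ t → ∑' z, k t z = 1
  semi : ∀ s t, 0 ≤ s → 0 ≤ t → ∀ z, k (s + t) z = ∑' w, k s w * k t (z - w)

lemma ne_top_of_tsum_rpow (f : G → ℝ≥0∞) (p : ℝ) (hp : 1 ≤ p) (hf : ∑' x, f x ^ p ≠ ∞) (x : G) :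
    f x ≠ ∞ := by
  have h1 := ENNReal.ne_top_of_tsum_ne_top hf x
  intro h
  rw [h, ENNReal.top_rpow_of_pos (by linarith)] at h1
  exact h1 rfl

lemma bilin_m [Countable G] (k : ℝ → G → ℝ≥0∞) (hk : MarkovK k) (m : ℝ) (hm : 1 ≤ m)
    (τ : ℕ → ℝ) (h0 : 0 ≤ τ 0) (hτ : Monotone τ) (f g : G → ℝ≥0∞)
    (hf : ∑' x, f x ^ (m + 1) ≠ ∞) (hg : ∑' x, g x ^ (1 + 1 / m) ≠ ∞) (N : ℕ) :
    ∑ n ∈ Finset.range N, |(∑' x, PP (k (τ (n + 1))) f x * g x).toReal -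
      (∑' x, PP (k (τ n)) f x * g x).toReal| ≤
      (7 * m ^ 2 + 2) * (∑' x, f x ^ (m + 1) + ∑' x, g x ^ (1 + 1 / m)).toReal := by
  have hm0 : 0 < m := by linarith
  have hq : 1 ≤ 1 + 1 / m := by
    have : 0 < 1 / m := by positivity
    linarith
  have hp : 1 ≤ m + 1 := by linarith
  have hpos : ∀ n, 0 ≤ τ n := fun n => h0.trans (hτ (Nat.zero_le n))
  have hpos2 : ∀ n, 0 ≤ τ n / 2 := fun n => by have := hpos n; positivity
  let F : ℕ → G → ℝ≥0∞ := fun n => PP (k (τ n / 2)) f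
  let H : ℕ → G → ℝ≥0∞ := fun n => PP (k (τ n / 2)) g
  have hFt : ∀ n x, F n x ≠ ∞ := fun n x => PP_ne_top _ f (hk.one _ (hpos2 n)) _ hp hf x
  have hHt : ∀ n x, H n x ≠ ∞ := fun n x => PP_ne_top _ g (hk.one _ (hpos2 n)) _ hq hg x
  have hft := ne_top_of_tsum_rpow f _ hp hf
  have hgt := ne_top_of_tsum_rpow g _ hq hg
  have hD : ∀ n, ∑' x, PP (k (τ n)) f x * g x = ∑' x, F n x * H n x := by
    intro n
    rw [← PP_symm (k (τ n / 2)) (F n) g (hk.symm _ (hpos2 n))]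
    refine tsum_congr fun x => ?_
    rw [← PP_comp (k (τ n / 2)) (k (τ n / 2)) (k (τ n)) f]
    intro z
    have := hk.semi _ _ (hpos2 n) (hpos2 n) z
    rwa [add_halves] at this
  have hδ : ∀ n, 0 ≤ (τ (n + 1) - τ n) / 2 := fun n => by
    have := hτ (Nat.le_succ n); simp only [Nat.succ_eq_add_one] at this; linarith
  have hstep : ∀ (φ : G → ℝ≥0∞) n, PP (k (τ (n + 1) / 2)) φ =
      PP (k ((τ (n + 1) - τ n) / 2)) (PP (k (τ n / 2)) φ) := by
    intro φ n
    funext x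
    refine PP_comp _ _ _ _ (fun z => ?_) x
    have := hk.semi _ _ (hpos2 n) (hδ n) z
    rw [← this]; congr 1; ring
  have hEb := EE_le m hm f g hft hgt
  have hfin : ∑' x, f x ^ (m + 1) + ∑' x, g x ^ (1 + 1 / m) ≠ ∞ := ENNReal.add_ne_top.2 ⟨hf, hg⟩
  have hEfin : EE m f g ≠ ∞ := ne_top_of_le_ne_top (ENNReal.mul_ne_top ENNReal.ofReal_ne_top hfin) hEb
  obtain ⟨z1, z2⟩ := step m hm (k (τ 0 / 2)) f g (hk.one _ (hpos2 0)) hft hgt (hFt 0) (hHt 0) hEfin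
  have hst : ∀ n, EE m (F n) (H n) ≠ ∞ → EE m (F (n + 1)) (H (n + 1)) ≠ ∞ ∧
      |(∑' x, F (n + 1) x * H (n + 1) x).toReal - (∑' x, F n x * H n x).toReal| ≤
      (EE m (F n) (H n)).toReal - (EE m (F (n + 1)) (H (n + 1))).toReal := by
    intro n hn
    have h1 : F (n + 1) = PP (k ((τ (n + 1) - τ n) / 2)) (F n) := hstep f n
    have h2 : H (n + 1) = PP (k ((τ (n + 1) - τ n) / 2)) (H n) := hstep g n
    have := step m hm (k ((τ (n + 1) - τ n) / 2)) (F n) (H n) (hk.one _ (hδ n)) (hFt n) (hHt n)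
      (fun x => by rw [← h1]; exact hFt _ x) (fun x => by rw [← h2]; exact hHt _ x) hn
    rwa [← h1, ← h2] at this
  have hEn : ∀ n, EE m (F n) (H n) ≠ ∞ := by
    intro n
    induction n with
    | zero => exact z1
    | succ n ih => exact (hst n ih).1
  simp only [hD]
  have hE0 : (EE m (F 0) (H 0)).toReal ≤ (EE m f g).toReal := by
    have := (abs_nonneg _).trans z2
    linarith
  have hE1 : (EE m f g).toReal ≤ (7 * m ^ 2 + 2) *
      (∑' x, f x ^ (m + 1) + ∑' x, g x ^ (1 + 1 / m)).toReal := by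
    have := ENNReal.toReal_mono (ENNReal.mul_ne_top ENNReal.ofReal_ne_top hfin) hEb
    rwa [ENNReal.toReal_mul, ENNReal.toReal_ofReal (by positivity)] at this
  have htel : ∑ n ∈ Finset.range N, |(∑' x, F (n + 1) x * H (n + 1) x).toReal -
      (∑' x, F n x * H n x).toReal| ≤ (EE m (F 0) (H 0)).toReal - (EE m (F N) (H N)).toReal := by
    induction N with
    | zero => simp
    | succ N ih =>
      rw [Finset.sum_range_succ]
      have := (hst N (hEn N)).2
      linarith
  have : 0 ≤ (EE m (F N) (H N)).toReal := ENNReal.toReal_nonneg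
  linarith

end Abstract

section LP
variable {G : Type*} [AddCommGroup G]

/-- bilinear constant -/
noncomputable def Cb (p : ℝ) : ℝ := 7 * (max (p - 1) (1 / (p - 1))) ^ 2 + 2

lemma Cb_pos (p : ℝ) : 0 < Cb p := by unfold Cb; positivity

lemma bilin_p [Countable G] (k : ℝ → G → ℝ≥0∞) (hk : MarkovK k) (p : ℝ) (hp : 1 < p)
    (τ : ℕ → ℝ) (h0 : 0 ≤ τ 0) (hτ : Monotone τ) (f g : G → ℝ≥0∞)
    (hf : ∑' x, f x ^ p ≠ ∞) (hg : ∑' x, g x ^ (p / (p - 1)) ≠ ∞) (N : ℕ) :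
    ∑ n ∈ Finset.range N, |(∑' x, PP (k (τ (n + 1))) f x * g x).toReal -
      (∑' x, PP (k (τ n)) f x * g x).toReal| ≤
      Cb p * (∑' x, f x ^ p + ∑' x, g x ^ (p / (p - 1))).toReal := by
  have hp1 : 0 < p - 1 := by linarith
  rcases le_total 2 p with h | h
  · have e1 : p - 1 + 1 = p := by ring
    have e2 : 1 + 1 / (p - 1) = p / (p - 1) := by field_simp; ring
    have hm : max (p - 1) (1 / (p - 1)) = p - 1 := by
      apply max_eq_left
      rw [div_le_iff₀ hp1]; nlinarith
    have := bilin_m k hk (p - 1) (by linarith) τ h0 hτ f g (by rwa [e1]) (by rwa [e2]) N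
    rw [e1, e2] at this
    rwa [Cb, hm]
  · have e1 : 1 / (p - 1) + 1 = p / (p - 1) := by field_simp; ring
    have e2 : 1 + 1 / (1 / (p - 1)) = p := by field_simp; ring
    have h1 : 1 ≤ 1 / (p - 1) := by rw [le_div_iff₀ hp1]; linarith
    have hm : max (p - 1) (1 / (p - 1)) = 1 / (p - 1) := by
      apply max_eq_right; linarith
    have := bilin_m k hk (1 / (p - 1)) h1 τ h0 hτ g f (by rwa [e1]) (by rwa [e2]) N
    rw [e1, e2] at this
    have hs : ∀ n, ∑' x, PP (k (τ n)) f x * g x = ∑' x, PP (k (τ n)) g x * f x := by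
      intro n
      rw [PP_symm _ _ _ (hk.symm _ (h0.trans (hτ (Nat.zero_le n))))]
      exact tsum_congr fun x => mul_comm _ _
    simp only [hs]
    rw [Cb, hm, add_comm (∑' x, f x ^ p)]
    exact this

/-- differences -/
noncomputable def dd (k : ℝ → G → ℝ≥0∞) (τ : ℕ → ℝ) (f : G → ℝ≥0∞) (n : ℕ) (x : G) : ℝ :=
  (PP (k (τ (n + 1))) f x).toReal - (PP (k (τ n)) f x).toReal

lemma dual_lin [Countable G] (k : ℝ → G → ℝ≥0∞) (hk : MarkovK k) (p : ℝ) (hp : 1 < p)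
    (τ : ℕ → ℝ) (h0 : 0 ≤ τ 0) (hτ : Monotone τ) (f : G → ℝ≥0∞)
    (hf : ∑' x, f x ^ p ≠ ∞) (ε : ℕ → ℝ) (hε : ∀ n, |ε n| ≤ 1) (N : ℕ) (S : Finset G)
    (g : G → ℝ) (hg : ∀ x, 0 ≤ g x) :
    ∑ x ∈ S, (∑ n ∈ Finset.range N, ε n * dd k τ f n x) * g x ≤
      Cb p * ((∑' x, f x ^ p).toReal + ∑ x ∈ S, g x ^ (p / (p - 1))) := by
  classical
  have hp1 : 0 < p - 1 := by linarith
  have hq : 0 < p / (p - 1) := by positivity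
  let g' : G → ℝ≥0∞ := fun x => if x ∈ S then ENNReal.ofReal (g x) else 0
  have hg'q : ∑' x, g' x ^ (p / (p - 1)) = ENNReal.ofReal (∑ x ∈ S, g x ^ (p / (p - 1))) := by
    rw [tsum_eq_sum (s := S), ENNReal.ofReal_sum_of_nonneg]
    · refine Finset.sum_congr rfl fun x hx => ?_
      simp only [g', hx, if_true]
      rw [ENNReal.ofReal_rpow_of_nonneg (hg x) hq.le]
    · intro x _; exact Real.rpow_nonneg (hg x) _
    · intro x hx
      simp only [g', hx, if_false]
      exact ENNReal.zero_rpow_of_pos hq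
  have hD : ∀ n, (∑' x, PP (k (τ n)) f x * g' x).toReal =
      ∑ x ∈ S, (PP (k (τ n)) f x).toReal * g x := by
    intro n
    rw [tsum_eq_sum (s := S), ENNReal.toReal_sum]
    · refine Finset.sum_congr rfl fun x hx => ?_
      simp only [g', hx, if_true]
      rw [ENNReal.toReal_mul, ENNReal.toReal_ofReal (hg x)]
    · intro x hx
      simp only [g', hx, if_true]
      exact ENNReal.mul_ne_top (PP_ne_top _ f (hk.one _ (h0.trans (hτ (Nat.zero_le n)))) p hp.le hf x)
        ENNReal.ofReal_ne_top
    · intro x hx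
      simp only [g', hx, if_false, mul_zero]
  have hb := bilin_p k hk p hp τ h0 hτ f g' hf (by rw [hg'q]; exact ENNReal.ofReal_ne_top) N
  rw [hg'q, ENNReal.toReal_add hf ENNReal.ofReal_ne_top, ENNReal.toReal_ofReal
    (Finset.sum_nonneg fun x _ => Real.rpow_nonneg (hg x) _)] at hb
  refine le_trans ?_ hb
  have e : ∑ x ∈ S, (∑ n ∈ Finset.range N, ε n * dd k τ f n x) * g x =
      ∑ n ∈ Finset.range N, ε n * ((∑' x, PP (k (τ (n + 1))) f x * g' x).toReal -
      (∑' x, PP (k (τ n)) f x * g' x).toReal) := by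
    simp only [hD, Finset.sum_mul]
    rw [Finset.sum_comm]
    refine Finset.sum_congr rfl fun n _ => ?_
    rw [← Finset.sum_sub_distrib, Finset.mul_sum]
    refine Finset.sum_congr rfl fun x _ => ?_
    unfold dd; ring
  rw [e]
  refine Finset.sum_le_sum fun n _ => ?_
  refine (le_abs_self _).trans ?_
  rw [abs_mul]
  exact mul_le_of_le_one_left (abs_nonneg _) (hε n)

/-- the duality constant -/
noncomputable def Cd (p : ℝ) : ℝ := 2 * Cb p / (1 / (2 * Cb p)) ^ (p - 1)

lemma Cd_pos (p : ℝ) : 0 < Cd p := by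
  have := Cb_pos p
  unfold Cd; positivity

lemma dual_pos [Countable G] (k : ℝ → G → ℝ≥0∞) (hk : MarkovK k) (p : ℝ) (hp : 1 < p)
    (τ : ℕ → ℝ) (h0 : 0 ≤ τ 0) (hτ : Monotone τ) (f : G → ℝ≥0∞)
    (hf : ∑' x, f x ^ p ≠ ∞) (ε : ℕ → ℝ) (hε : ∀ n, |ε n| ≤ 1) (N : ℕ) (S : Finset G) :
    ∑ x ∈ S, (max (∑ n ∈ Finset.range N, ε n * dd k τ f n x) 0) ^ p ≤
      Cd p * (∑' x, f x ^ p).toReal := by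
  have hp1 : 0 < p - 1 := by linarith
  have hC := Cb_pos p
  set C := Cb p with hCdef
  let η : ℝ := (1 / (2 * C)) ^ (p - 1)
  have hη : 0 < η := by positivity
  set X : G → ℝ := fun x => ∑ n ∈ Finset.range N, ε n * dd k τ f n x with hX
  have hb := dual_lin k hk p hp τ h0 hτ f hf ε hε N S (fun x => η * (max (X x) 0) ^ (p - 1))
    (fun x => by positivity)
  rw [← hCdef] at hb
  have e1 : ∀ x, X x * (η * (max (X x) 0) ^ (p - 1)) = η * (max (X x) 0) ^ p := by
    intro x
    rcases le_or_gt (X x) 0 with h | h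
    · rw [max_eq_right h, Real.zero_rpow hp1.ne', Real.zero_rpow (by linarith)]; ring
    · rw [max_eq_left h.le, Real.rpow_sub_one h.ne']
      field_simp
  have e2 : ∀ x, (η * (max (X x) 0) ^ (p - 1)) ^ (p / (p - 1)) =
      η * (1 / (2 * C)) * (max (X x) 0) ^ p := by
    intro x
    have ep : (p - 1) * (p / (p - 1)) = p := by field_simp
    have hη2 : η ^ (p / (p - 1)) = η * (1 / (2 * C)) := by
      simp only [η]
      rw [← Real.rpow_mul (by positivity), ep, Real.rpow_sub_one (by positivity)]
      field_simp
    rw [Real.mul_rpow hη.le (by positivity), hη2, ← Real.rpow_mul (by positivity), ep]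
  simp only [e2] at hb
  have hb' : ∑ x ∈ S, η * (max (X x) 0) ^ p ≤ C * ((∑' x, f x ^ p).toReal +
      ∑ x ∈ S, η * (1 / (2 * C)) * (max (X x) 0) ^ p) := by
    refine le_trans (le_of_eq ?_) hb
    exact Finset.sum_congr rfl fun x _ => (e1 x).symm
  rw [← Finset.mul_sum, ← Finset.mul_sum] at hb'
  set Y := ∑ x ∈ S, (max (X x) 0) ^ p
  have h2 : C * ((∑' x, f x ^ p).toReal + η * (1 / (2 * C)) * Y) =
      C * (∑' x, f x ^ p).toReal + η * Y / 2 := by field_simp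
  rw [h2] at hb'
  have h3 : Y * η ≤ 2 * C * (∑' x, f x ^ p).toReal := by linarith
  rw [← le_div_iff₀ hη] at h3
  refine h3.trans (le_of_eq ?_)
  simp only [Cd, ← hCdef, η]; ring

lemma dual_abs [Countable G] (k : ℝ → G → ℝ≥0∞) (hk : MarkovK k) (p : ℝ) (hp : 1 < p)
    (τ : ℕ → ℝ) (h0 : 0 ≤ τ 0) (hτ : Monotone τ) (f : G → ℝ≥0∞)
    (hf : ∑' x, f x ^ p ≠ ∞) (ε : ℕ → ℝ) (hε : ∀ n, |ε n| ≤ 1) (N : ℕ) (S : Finset G) :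
    ∑ x ∈ S, |∑ n ∈ Finset.range N, ε n * dd k τ f n x| ^ p ≤
      2 * Cd p * (∑' x, f x ^ p).toReal := by
  have h1 := dual_pos k hk p hp τ h0 hτ f hf ε hε N S
  have h2 := dual_pos k hk p hp τ h0 hτ f hf (fun n => - ε n) (fun n => by rw [abs_neg]; exact hε n) N S
  simp only [neg_mul, Finset.sum_neg_distrib] at h2
  have : ∑ x ∈ S, |∑ n ∈ Finset.range N, ε n * dd k τ f n x| ^ p ≤
      ∑ x ∈ S, (max (∑ n ∈ Finset.range N, ε n * dd k τ f n x) 0) ^ p +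
      ∑ x ∈ S, (max (-∑ n ∈ Finset.range N, ε n * dd k τ f n x) 0) ^ p := by
    rw [← Finset.sum_add_distrib]
    refine Finset.sum_le_sum fun x _ => ?_
    set X := ∑ n ∈ Finset.range N, ε n * dd k τ f n x
    rcases le_total X 0 with h | h
    · rw [abs_of_nonpos h, max_eq_left (a := -X) (by linarith)]
      have : 0 ≤ (max X 0) ^ p := by positivity
      linarith
    · rw [abs_of_nonneg h, max_eq_left h]
      have : 0 ≤ (max (-X) 0) ^ p := by positivity
      linarith
  linarith

/-- random sign sum -/
noncomputable def rad (c : ℕ → ℝ) (s A : Finset ℕ) : ℝ :=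
  ∑ n ∈ s, (if n ∈ A then (1 : ℝ) else -1) * c n

lemma rad_insert (c : ℕ → ℝ) (s A : Finset ℕ) (a : ℕ) (ha : a ∉ s) (hA : A ⊆ s) :
    rad c (insert a s) A = rad c s A - c a ∧
    rad c (insert a s) (insert a A) = rad c s A + c a := by
  have haA : a ∉ A := fun h => ha (hA h)
  unfold rad
  rw [Finset.sum_insert ha, Finset.sum_insert ha]
  constructor
  · simp [haA]; ring
  · have : ∑ n ∈ s, (if n ∈ insert a A then (1 : ℝ) else -1) * c n =
        ∑ n ∈ s, (if n ∈ A then (1 : ℝ) else -1) * c n := by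
      refine Finset.sum_congr rfl fun n hn => ?_
      have : n ≠ a := fun h => ha (h ▸ hn)
      simp [Finset.mem_insert, this]
    rw [this]; simp; ring

lemma rad_moments (c : ℕ → ℝ) (s : Finset ℕ) :
    ∑ A ∈ s.powerset, rad c s A ^ 2 = 2 ^ s.card * ∑ n ∈ s, c n ^ 2 ∧
    ∑ A ∈ s.powerset, rad c s A ^ 4 ≤ 3 * 2 ^ s.card * (∑ n ∈ s, c n ^ 2) ^ 2 := by
  induction s using Finset.induction_on with
  | empty => simp [rad]
  | insert a s ha ih =>
    obtain ⟨i1, i2⟩ := ih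
    have key : ∀ j : ℕ, ∑ A ∈ (insert a s).powerset, rad c (insert a s) A ^ j =
        ∑ A ∈ s.powerset, ((rad c s A - c a) ^ j + (rad c s A + c a) ^ j) := by
      intro j
      rw [Finset.sum_powerset_insert ha, ← Finset.sum_add_distrib]
      refine Finset.sum_congr rfl fun A hA => ?_
      obtain ⟨h1, h2⟩ := rad_insert c s A a ha (Finset.mem_powerset.1 hA)
      rw [h1, h2]
    rw [key, key, Finset.card_insert_of_notMem ha, Finset.sum_insert ha]
    set σ := ∑ n ∈ s, c n ^ 2
    have hcard : ∑ A ∈ s.powerset, (1 : ℝ) = 2 ^ s.card := by simp [Finset.card_powerset]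
    constructor
    · calc _ = ∑ A ∈ s.powerset, (2 * rad c s A ^ 2 + 2 * c a ^ 2 * 1) := by
            refine Finset.sum_congr rfl fun A _ => ?_
            ring
        _ = _ := by
            rw [Finset.sum_add_distrib, ← Finset.mul_sum, ← Finset.mul_sum, i1, hcard]; ring
    · calc _ = ∑ A ∈ s.powerset, (2 * rad c s A ^ 4 + 12 * c a ^ 2 * rad c s A ^ 2 +
              2 * c a ^ 4 * 1) := by
            refine Finset.sum_congr rfl fun A _ => ?_
            ring
        _ = 2 * (∑ A ∈ s.powerset, rad c s A ^ 4) + 12 * c a ^ 2 * (2 ^ s.card * σ) +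
              2 * c a ^ 4 * 2 ^ s.card := by
            rw [Finset.sum_add_distrib, Finset.sum_add_distrib, ← Finset.mul_sum,
              ← Finset.mul_sum, ← Finset.mul_sum, i1, hcard]
        _ ≤ _ := by
            have : (0:ℝ) ≤ c a ^ 4 * 2 ^ s.card := by positivity
            rw [pow_succ (2 : ℝ)]
            nlinarith [i2]

lemma khin (c : ℕ → ℝ) (s : Finset ℕ) (p : ℝ) (hp : 1 ≤ p) :
    (∑ n ∈ s, c n ^ 2) ^ (p / 2) ≤
      2 ^ p * ∑ A ∈ s.powerset, (1 / 2 ^ s.card : ℝ) * |rad c s A| ^ p := by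
  obtain ⟨m2, m4⟩ := rad_moments c s
  have hσ0 : 0 ≤ ∑ n ∈ s, c n ^ 2 := Finset.sum_nonneg fun n _ => sq_nonneg _
  rcases hσ0.eq_or_lt with h | hpos
  · rw [← h, Real.zero_rpow (by positivity)]
    positivity
  set V := ∑ n ∈ s, c n ^ 2
  set σ := Real.sqrt V with hσ
  have hσp : 0 < σ := Real.sqrt_pos.2 hpos
  have hσ2 : σ ^ 2 = V := Real.sq_sqrt hσ0
  have hV : V ^ (p / 2) = σ ^ p := by
    rw [hσ, Real.sqrt_eq_rpow, ← Real.rpow_mul hσ0]; congr 1; ring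
  have hw : ∑ A ∈ s.powerset, (1 / 2 ^ s.card : ℝ) = 1 := by
    simp [Finset.card_powerset]
  have hJ := Real.rpow_arith_mean_le_arith_mean_rpow s.powerset (fun _ => (1 / 2 ^ s.card : ℝ))
    (fun A => |rad c s A|) (fun _ _ => by positivity) hw (fun _ _ => abs_nonneg _) hp
  have hE : σ / 2 ≤ ∑ A ∈ s.powerset, (1 / 2 ^ s.card : ℝ) * |rad c s A| := by
    have hpt : ∀ A, |rad c s A| ≥ rad c s A ^ 2 / σ - rad c s A ^ 4 / (6 * σ ^ 3) := by
      intro A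
      set r := rad c s A
      obtain ⟨y, hy⟩ : ∃ y, y = |r| / σ := ⟨_, rfl⟩
      have hy0 : 0 ≤ y := by rw [hy]; positivity
      have hr : |r| = y * σ := by rw [hy]; field_simp
      have e2 : r ^ 2 = (y * σ) ^ 2 := by rw [← hr, sq_abs]
      have e4 : r ^ 4 = (y * σ) ^ 4 := by rw [show r ^ 4 = (r ^ 2) ^ 2 by ring, e2]; ring
      rw [hr, e2, e4]
      have : (y * σ) ^ 2 / σ - (y * σ) ^ 4 / (6 * σ ^ 3) = σ * (y ^ 2 - y ^ 4 / 6) := by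
        field_simp
      rw [this]
      have h3 : y - y ^ 3 / 6 ≤ 1 := by
        nlinarith [sq_nonneg (y - 3 / 2), mul_nonneg hy0 (sq_nonneg (y - 3 / 2)), sq_nonneg (y - 1)]
      have h4 : y ^ 2 - y ^ 4 / 6 ≤ y := by nlinarith
      nlinarith
    calc σ / 2 ≤ ∑ A ∈ s.powerset, (1 / 2 ^ s.card : ℝ) *
          (rad c s A ^ 2 / σ - rad c s A ^ 4 / (6 * σ ^ 3)) := by
          rw [← Finset.mul_sum, Finset.sum_sub_distrib, ← Finset.sum_div, ← Finset.sum_div, m2]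
          have : (∑ A ∈ s.powerset, rad c s A ^ 4) / (6 * σ ^ 3) ≤
              (3 * 2 ^ s.card * V ^ 2) / (6 * σ ^ 3) := by gcongr
          have e : (1 / 2 ^ s.card : ℝ) * (2 ^ s.card * V / σ - (3 * 2 ^ s.card * V ^ 2) / (6 * σ ^ 3))
              = σ / 2 := by
            rw [← hσ2]; field_simp; ring
          rw [← e]
          gcongr
      _ ≤ _ := by
          refine Finset.sum_le_sum fun A _ => ?_
          gcongr
          exact hpt A
  rw [hV]
  have : (σ / 2) ^ p ≤ _ := (Real.rpow_le_rpow (by positivity) hE (by linarith)).trans hJ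
  rw [Real.div_rpow hσp.le (by norm_num), div_le_iff₀ (by positivity)] at this
  linarith

/-- square function constant -/
noncomputable def Cs (p : ℝ) : ℝ := 2 ^ p * (2 * Cd p)

lemma Cs_pos (p : ℝ) : 0 < Cs p := by
  have := Cd_pos p
  unfold Cs; positivity

lemma square_fin [Countable G] (k : ℝ → G → ℝ≥0∞) (hk : MarkovK k) (p : ℝ) (hp : 1 < p)
    (τ : ℕ → ℝ) (h0 : 0 ≤ τ 0) (hτ : Monotone τ) (f : G → ℝ≥0∞)
    (hf : ∑' x, f x ^ p ≠ ∞) (N : ℕ) (S : Finset G) :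
    ∑ x ∈ S, (∑ n ∈ Finset.range N, dd k τ f n x ^ 2) ^ (p / 2) ≤
      Cs p * (∑' x, f x ^ p).toReal := by
  set s := Finset.range N
  have hw : ∑ A ∈ s.powerset, (1 / 2 ^ s.card : ℝ) = 1 := by
    simp [Finset.card_powerset]
  calc _ ≤ ∑ x ∈ S, 2 ^ p * ∑ A ∈ s.powerset, (1 / 2 ^ s.card : ℝ) *
        |rad (fun n => dd k τ f n x) s A| ^ p :=
        Finset.sum_le_sum fun x _ => khin _ s p hp.le
    _ = 2 ^ p * ∑ A ∈ s.powerset, (1 / 2 ^ s.card : ℝ) *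
        ∑ x ∈ S, |rad (fun n => dd k τ f n x) s A| ^ p := by
        rw [← Finset.mul_sum, Finset.sum_comm]
        simp only [Finset.mul_sum]
    _ ≤ 2 ^ p * ∑ A ∈ s.powerset, (1 / 2 ^ s.card : ℝ) *
        (2 * Cd p * (∑' x, f x ^ p).toReal) := by
        gcongr with A _
        refine dual_abs k hk p hp τ h0 hτ f hf _ (fun n => ?_) N S
        split_ifs <;> simp
    _ = _ := by
        rw [← Finset.sum_mul, hw]; unfold Cs; ring
end LP

section Final

lemma poisson_eq (d : ℕ) (k : ℝ → (Fin d → ℤ) → ℝ≥0∞) (t : ℝ)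
    (hk : ∀ z, k t z ≠ ∞ ∧ poissonKer d t z = ((k t z).toReal : ℂ)) (h1 : ∑' z, k t z = 1)
    (p : ℝ) (hp : 1 ≤ p) (f : (Fin d → ℤ) → ℂ) (f1 f2 f3 f4 : (Fin d → ℤ) → ℝ≥0∞)
    (i1 : ∑' x, f1 x ^ p ≠ ∞) (i2 : ∑' x, f2 x ^ p ≠ ∞) (i3 : ∑' x, f3 x ^ p ≠ ∞)
    (i4 : ∑' x, f4 x ^ p ≠ ∞)
    (hf : ∀ x, f x = (((f1 x).toReal : ℂ) - (f2 x).toReal) +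
      Complex.I * ((f3 x).toReal - (f4 x).toReal)) (x : Fin d → ℤ) :
    poisson d t f x = (((PP (k t) f1 x).toReal : ℂ) - (PP (k t) f2 x).toReal) +
      Complex.I * ((PP (k t) f3 x).toReal - (PP (k t) f4 x).toReal) := by
  have hs : ∀ φ : (Fin d → ℤ) → ℝ≥0∞, ∑' x, φ x ^ p ≠ ∞ →
      HasSum (fun y => (((k t (x - y)).toReal * (φ y).toReal : ℝ) : ℂ))
        (((PP (k t) φ x).toReal : ℝ) : ℂ) := by
    intro φ hφ
    rw [Complex.hasSum_ofReal]
    have hn := PP_ne_top (k t) φ h1 p hp hφ x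
    have := ENNReal.hasSum_toReal hn
    simp only [ENNReal.toReal_mul] at this
    rw [PP, ENNReal.tsum_toReal_eq (ENNReal.ne_top_of_tsum_ne_top hn)]
    simpa only [ENNReal.toReal_mul] using this
  have := ((hs f1 i1).sub (hs f2 i2)).add (((hs f3 i3).sub (hs f4 i4)).mul_left Complex.I)
  rw [← this.tsum_eq, poisson]
  refine tsum_congr fun y => ?_
  rw [(hk _).2, hf y]
  push_cast; ring

lemma four_pow (p u1 u2 u3 u4 : ℝ) (hp : 0 < p) (h1 : 0 ≤ u1) (h2 : 0 ≤ u2) (h3 : 0 ≤ u3)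
    (h4 : 0 ≤ u4) : (2 * (u1 + u2 + u3 + u4)) ^ (p / 2) ≤
      8 ^ (p / 2) * (u1 ^ (p / 2) + u2 ^ (p / 2) + u3 ^ (p / 2) + u4 ^ (p / 2)) := by
  have hp2 : 0 ≤ p / 2 := by positivity
  have r1 := Real.rpow_nonneg h1 (p / 2)
  have r2 := Real.rpow_nonneg h2 (p / 2)
  have r3 := Real.rpow_nonneg h3 (p / 2)
  have r4 := Real.rpow_nonneg h4 (p / 2)
  have key : ∀ u, 0 ≤ u → u1 ≤ u → u2 ≤ u → u3 ≤ u → u4 ≤ u →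
      (2 * (u1 + u2 + u3 + u4)) ^ (p / 2) ≤ 8 ^ (p / 2) * u ^ (p / 2) := by
    intro u hu a b c e
    rw [← Real.mul_rpow (by norm_num) hu]
    exact Real.rpow_le_rpow (by positivity) (by linarith) hp2
  have h8 : (0:ℝ) ≤ 8 ^ (p / 2) := by positivity
  rcases le_total u1 u2 with a | a <;> rcases le_total u3 u4 with b | b
  · rcases le_total u2 u4 with c | c
    · exact (key u4 h4 (a.trans c) c b le_rfl).trans (mul_le_mul_of_nonneg_left (by linarith) h8)
    · exact (key u2 h2 a le_rfl (b.trans c) c).trans (mul_le_mul_of_nonneg_left (by linarith) h8)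
  · rcases le_total u2 u3 with c | c
    · exact (key u3 h3 (a.trans c) c le_rfl b).trans (mul_le_mul_of_nonneg_left (by linarith) h8)
    · exact (key u2 h2 a le_rfl c (b.trans c)).trans (mul_le_mul_of_nonneg_left (by linarith) h8)
  · rcases le_total u1 u4 with c | c
    · exact (key u4 h4 c (a.trans c) b le_rfl).trans (mul_le_mul_of_nonneg_left (by linarith) h8)
    · exact (key u1 h1 le_rfl a (b.trans c) c).trans (mul_le_mul_of_nonneg_left (by linarith) h8)
  · rcases le_total u1 u3 with c | c
    · exact (key u3 h3 c (a.trans c) le_rfl b).trans (mul_le_mul_of_nonneg_left (by linarith) h8)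
    · exact (key u1 h1 le_rfl a c (b.trans c)).trans (mul_le_mul_of_nonneg_left (by linarith) h8)

/-- final constant -/
noncomputable def Cf (p : ℝ) : ℝ := 8 ^ (p / 2) * (4 * Cs p)

lemma Cf_pos (p : ℝ) : 0 < Cf p := by
  have := Cs_pos p
  unfold Cf; positivity

lemma norm_four (a b c e : ℝ) :
    ‖((a : ℂ) - b) + Complex.I * (c - e)‖ ^ 2 ≤ 2 * (a ^ 2 + b ^ 2 + c ^ 2 + e ^ 2) := by
  rw [← Complex.normSq_eq_norm_sq, Complex.normSq_apply]
  simp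
  nlinarith [sq_nonneg (a + b), sq_nonneg (c + e)]

lemma square_complex (d : ℕ) (p : ℝ) (hp : 1 < p)
    (τ : ℕ → ℝ) (h0 : 0 ≤ τ 0) (hτ : Monotone τ) (f : (Fin d → ℤ) → ℂ)
    (hf : ∑' x, nnC f x ^ p ≠ ∞) (N : ℕ) (S : Finset (Fin d → ℤ)) :
    ∑ x ∈ S, (∑ n ∈ Finset.range N,
      ‖poisson d (τ (n + 1)) f x - poisson d (τ n) f x‖ ^ 2) ^ (p / 2) ≤
      Cf p * (∑' x, nnC f x ^ p).toReal := by
  obtain ⟨k, hk1, hk2, hk3, hk4⟩ := kernel_exists d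
  have hk : MarkovK k := ⟨hk2, hk3, hk4⟩
  have hpos : ∀ n, 0 ≤ τ n := fun n => h0.trans (hτ (Nat.zero_le n))
  set f1 : (Fin d → ℤ) → ℝ≥0∞ := fun x => ENNReal.ofReal (f x).re with hf1
  set f2 : (Fin d → ℤ) → ℝ≥0∞ := fun x => ENNReal.ofReal (-(f x).re) with hf2
  set f3 : (Fin d → ℤ) → ℝ≥0∞ := fun x => ENNReal.ofReal (f x).im with hf3
  set f4 : (Fin d → ℤ) → ℝ≥0∞ := fun x => ENNReal.ofReal (-(f x).im) with hf4
  have hle : ∀ u : ℝ, ∀ x, |u| ≤ ‖f x‖ → ENNReal.ofReal u ^ p ≤ nnC f x ^ p := by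
    intro u x h
    refine ENNReal.rpow_le_rpow ?_ (by linarith)
    have : nnC f x = ENNReal.ofReal ‖f x‖ := by
      rw [nnC, ofReal_norm]; rfl
    rw [this]
    exact ENNReal.ofReal_le_ofReal ((le_abs_self u).trans h)
  have l1 : ∑' x, f1 x ^ p ≤ ∑' x, nnC f x ^ p :=
    ENNReal.tsum_le_tsum fun x => hle _ x (Complex.abs_re_le_norm _)
  have l2 : ∑' x, f2 x ^ p ≤ ∑' x, nnC f x ^ p :=
    ENNReal.tsum_le_tsum fun x => hle _ x (by rw [abs_neg]; exact Complex.abs_re_le_norm _)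
  have l3 : ∑' x, f3 x ^ p ≤ ∑' x, nnC f x ^ p :=
    ENNReal.tsum_le_tsum fun x => hle _ x (Complex.abs_im_le_norm _)
  have l4 : ∑' x, f4 x ^ p ≤ ∑' x, nnC f x ^ p :=
    ENNReal.tsum_le_tsum fun x => hle _ x (by rw [abs_neg]; exact Complex.abs_im_le_norm _)
  have i1 := ne_top_of_le_ne_top hf l1
  have i2 := ne_top_of_le_ne_top hf l2
  have i3 := ne_top_of_le_ne_top hf l3
  have i4 := ne_top_of_le_ne_top hf l4
  have hpm : ∀ u : ℝ, (ENNReal.ofReal u).toReal - (ENNReal.ofReal (-u)).toReal = u := by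
    intro u
    rw [ENNReal.toReal_ofReal', ENNReal.toReal_ofReal']
    rcases le_total u 0 with h | h
    · rw [max_eq_right h, max_eq_left (by linarith)]; ring
    · rw [max_eq_left h, max_eq_right (by linarith)]; ring
  have hdec : ∀ x, f x = (((f1 x).toReal : ℂ) - (f2 x).toReal) +
      Complex.I * ((f3 x).toReal - (f4 x).toReal) := by
    intro x
    rw [← Complex.ofReal_sub, ← Complex.ofReal_sub, hpm, hpm]
    rw [mul_comm]; exact (Complex.re_add_im _).symm
  have hP : ∀ n x, poisson d (τ n) f x = (((PP (k (τ n)) f1 x).toReal : ℂ) -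
      (PP (k (τ n)) f2 x).toReal) +
      Complex.I * ((PP (k (τ n)) f3 x).toReal - (PP (k (τ n)) f4 x).toReal) := fun n x =>
    poisson_eq d k (τ n) (hk1 _ (hpos n)) (hk3 _ (hpos n)) p hp.le f f1 f2 f3 f4 i1 i2 i3 i4 hdec x
  have hn : ∀ n x, ‖poisson d (τ (n + 1)) f x - poisson d (τ n) f x‖ ^ 2 ≤
      2 * (dd k τ f1 n x ^ 2 + dd k τ f2 n x ^ 2 + dd k τ f3 n x ^ 2 + dd k τ f4 n x ^ 2) := by
    intro n x
    refine le_trans (le_of_eq ?_) (norm_four _ _ _ _)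
    rw [hP, hP]
    unfold dd
    congr 2
    push_cast; ring
  let V : ((Fin d → ℤ) → ℝ≥0∞) → (Fin d → ℤ) → ℝ := fun φ x =>
    ∑ n ∈ Finset.range N, dd k τ φ n x ^ 2
  have hV0 : ∀ φ x, 0 ≤ V φ x := fun φ x => Finset.sum_nonneg fun n _ => sq_nonneg _
  have hV : ∀ φ, ∑' x, φ x ^ p ≠ ∞ → ∑ x ∈ S, V φ x ^ (p / 2) ≤ Cs p * (∑' x, φ x ^ p).toReal :=
    fun φ h => square_fin k hk p hp τ h0 hτ φ h N S
  have hC := Cs_pos p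
  have hV' : ∀ φ : (Fin d → ℤ) → ℝ≥0∞, ∑' x, φ x ^ p ≤ ∑' x, nnC f x ^ p →
      ∑ x ∈ S, V φ x ^ (p / 2) ≤ Cs p * (∑' x, nnC f x ^ p).toReal := fun φ h =>
    (hV φ (ne_top_of_le_ne_top hf h)).trans
      (mul_le_mul_of_nonneg_left (ENNReal.toReal_mono hf h) hC.le)
  calc _ ≤ ∑ x ∈ S, 8 ^ (p / 2) * (V f1 x ^ (p / 2) + V f2 x ^ (p / 2) + V f3 x ^ (p / 2) +
        V f4 x ^ (p / 2)) := by
        refine Finset.sum_le_sum fun x _ => ?_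
        refine le_trans ?_ (four_pow p _ _ _ _ (by linarith) (hV0 f1 x) (hV0 f2 x) (hV0 f3 x)
          (hV0 f4 x))
        refine Real.rpow_le_rpow (by positivity) ?_ (by positivity)
        simp only [V]
        rw [← Finset.sum_add_distrib, ← Finset.sum_add_distrib, ← Finset.sum_add_distrib,
          Finset.mul_sum]
        exact Finset.sum_le_sum fun n _ => hn n x
    _ = 8 ^ (p / 2) * (∑ x ∈ S, V f1 x ^ (p / 2) + ∑ x ∈ S, V f2 x ^ (p / 2) +
        ∑ x ∈ S, V f3 x ^ (p / 2) + ∑ x ∈ S, V f4 x ^ (p / 2)) := by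
        rw [← Finset.mul_sum, Finset.sum_add_distrib, Finset.sum_add_distrib,
          Finset.sum_add_distrib]
    _ ≤ 8 ^ (p / 2) * (4 * (Cs p * (∑' x, nnC f x ^ p).toReal)) := by
        gcongr
        linarith [hV' f1 l1, hV' f2 l2, hV' f3 l3, hV' f4 l4]
    _ = _ := by unfold Cf; ring

lemma square_ennreal (d : ℕ) (p : ℝ) (hp : 1 < p)
    (a : ℤ → ℝ) (h0 : ∀ n, 0 < a n) (ha : Monotone a) (f : (Fin d → ℤ) → ℂ)
    (hf : ∑' x, nnC f x ^ p ≠ ∞) :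
    ∑' x, (∑' n : ℤ,
      (‖poisson d (a n) f x - poisson d (a (n - 1)) f x‖₊ : ℝ≥0∞) ^ 2) ^ (p / 2) ≤
      ENNReal.ofReal (Cf p) * ∑' x, nnC f x ^ p := by
  have hp2 : 0 ≤ p / 2 := by positivity
  rw [ENNReal.tsum_eq_iSup_sum]
  refine iSup_le fun S => ?_
  have ht : Filter.Tendsto (fun s : Finset ℤ => ∑ x ∈ S, (∑ n ∈ s,
      (‖poisson d (a n) f x - poisson d (a (n - 1)) f x‖₊ : ℝ≥0∞) ^ 2) ^ (p / 2)) Filter.atTop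
      (nhds (∑ x ∈ S, (∑' n : ℤ,
      (‖poisson d (a n) f x - poisson d (a (n - 1)) f x‖₊ : ℝ≥0∞) ^ 2) ^ (p / 2))) := by
    refine tendsto_finsetSum _ fun x _ => ?_
    exact (ENNReal.continuous_rpow_const.tendsto _).comp ENNReal.summable.hasSum
  refine le_of_tendsto' ht fun s => ?_
  let M : ℕ := s.sup Int.natAbs + 1
  have hM : ∀ n ∈ s, n.natAbs + 1 ≤ M := fun n hn =>
    Nat.succ_le_succ (Finset.le_sup (f := Int.natAbs) hn)
  let τ : ℕ → ℝ := fun n => a (-(M : ℤ) + n)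
  have hτ : Monotone τ := fun i j hij => ha (by omega)
  have hb := square_complex d p hp τ (h0 _).le hτ f hf (2 * M) S
  have hsub : s ⊆ (Finset.range (2 * M)).image (fun n : ℕ => -(M : ℤ) + n + 1) := by
    intro n hn
    have := hM n hn
    rw [Finset.mem_image]
    refine ⟨(n + M - 1).toNat, ?_, ?_⟩
    · rw [Finset.mem_range]; omega
    · omega
  calc _ ≤ ∑ x ∈ S, (∑ n ∈ (Finset.range (2 * M)).image (fun n : ℕ => -(M : ℤ) + n + 1),
      (‖poisson d (a n) f x - poisson d (a (n - 1)) f x‖₊ : ℝ≥0∞) ^ 2) ^ (p / 2) :=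
        Finset.sum_le_sum fun x _ => ENNReal.rpow_le_rpow (Finset.sum_le_sum_of_subset hsub) hp2
    _ = ∑ x ∈ S, ENNReal.ofReal ((∑ n ∈ Finset.range (2 * M),
      ‖poisson d (τ (n + 1)) f x - poisson d (τ n) f x‖ ^ 2) ^ (p / 2)) := by
        refine Finset.sum_congr rfl fun x _ => ?_
        rw [← ENNReal.ofReal_rpow_of_nonneg (by positivity) hp2,
          ENNReal.ofReal_sum_of_nonneg (fun _ _ => by positivity),
          Finset.sum_image (fun i _ j _ h => by simpa using h)]
        congr 1
        refine Finset.sum_congr rfl fun n _ => ?_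
        rw [ENNReal.ofReal_pow (norm_nonneg _), ofReal_norm]
        simp only [τ]
        rw [show -(M : ℤ) + n + 1 - 1 = -(M : ℤ) + n by ring,
          show -(M : ℤ) + n + 1 = -(M : ℤ) + ((n + 1 : ℕ) : ℤ) by push_cast; ring]
        rfl
    _ = ENNReal.ofReal (∑ x ∈ S, (∑ n ∈ Finset.range (2 * M),
      ‖poisson d (τ (n + 1)) f x - poisson d (τ n) f x‖ ^ 2) ^ (p / 2)) := by
        rw [ENNReal.ofReal_sum_of_nonneg (fun _ _ => by positivity)]
    _ ≤ ENNReal.ofReal (Cf p * (∑' x, nnC f x ^ p).toReal) := ENNReal.ofReal_le_ofReal hb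
    _ = _ := by
        rw [ENNReal.ofReal_mul (Cf_pos p).le, ENNReal.ofReal_toReal hf]

end Final

/-- the dimension-free Littlewood–Paley inequality (4.12) for the Poisson
projections `S_n = P_{a_n} − P_{a_{n-1}}` associated with a lacunary sequence satisfying
`1 < A ≤ a_{n+1}/a_n ≤ A²`. -/
theorem statement13 (p : ℝ) (hp : 1 < p) :
    ∃ C : ℝ, 0 < C ∧ ∀ (d : ℕ) (A : ℝ), 1 < A → ∀ a : ℤ → ℝ, (∀ n, 0 < a n) →
      (∀ n : ℤ, A ≤ a (n + 1) / a n ∧ a (n + 1) / a n ≤ A ^ 2) →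
      ∀ f : (Fin d → ℤ) → ℂ, lpZ d (ENNReal.ofReal p) (nnC f) ≠ ∞ →
      lpZ d (ENNReal.ofReal p)
          (fun x => (∑' n : ℤ,
            (‖poisson d (a n) f x - poisson d (a (n - 1)) f x‖₊ : ℝ≥0∞) ^ 2) ^ (1 / 2 : ℝ))
        ≤ ENNReal.ofReal (C * A) * lpZ d (ENNReal.ofReal p) (nnC f) := by
  have hp0 : 0 < p := by linarith
  have hK := Cf_pos p
  refine ⟨Cf p ^ (1 / p), by positivity, ?_⟩
  intro d A hA a ha hr f hf
  have hmono : Monotone a := by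
    refine monotone_int_of_le_succ fun n => ?_
    have h1 := (hr n).1
    rw [le_div_iff₀ (ha n)] at h1
    have := ha n
    nlinarith
  have hto : (ENNReal.ofReal p).toReal = p := ENNReal.toReal_ofReal hp0.le
  simp only [lpZ, ENNReal.ofReal_ne_top, if_false, hto] at hf ⊢
  have hΦ : ∑' x, nnC f x ^ p ≠ ∞ := by
    intro h
    rw [h] at hf
    exact hf (ENNReal.top_rpow_of_pos (by positivity))
  have hm := square_ennreal d p hp a ha hmono f hΦ
  simp only [← ENNReal.rpow_mul, show (1 / 2 : ℝ) * p = p / 2 by ring]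
  calc _ ≤ (ENNReal.ofReal (Cf p) * ∑' x, nnC f x ^ p) ^ (1 / p) :=
        ENNReal.rpow_le_rpow hm (by positivity)
    _ = ENNReal.ofReal (Cf p ^ (1 / p)) * (∑' x, nnC f x ^ p) ^ (1 / p) := by
        rw [ENNReal.mul_rpow_of_nonneg _ _ (by positivity),
          ENNReal.ofReal_rpow_of_nonneg hK.le (by positivity)]
    _ ≤ _ := by
        gcongr
        exact le_mul_of_one_le_right (by positivity) hA.le
end

section
/- For every n ∈ ℕ₀, every r ≥ 1, and every function 𝔞 : [2^n, 2^{n+1}] → ℂ satisfying 𝔞(t) = 𝔞(⌊t⌋) for all t, one has sup_{2^n ≤ t < 2^{n+1}} |𝔞(t) − 𝔞(2^n)| ≤ 2^{1−1/r} Σ_{l=0}^{n} ( Σ_{k=0}^{2^l − 1} |𝔞(2^n + 2^{n−l}(k+1)) − 𝔞(2^n + 2^{n−l}k)|^r )^{1/r}. -/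
open ENNReal

lemma aux14_term (r : ℝ) (hr : 1 ≤ r) (f : ℕ → ℝ≥0∞) (N i : ℕ) (hi : i < N) :
    f i ≤ (∑ k ∈ Finset.range N, f k ^ r) ^ (1 / r) := by
  have h0 : 0 < r := by linarith
  rw [one_div, ENNReal.le_rpow_inv_iff h0]
  exact Finset.single_le_sum (f := fun k => f k ^ r) (fun _ _ => zero_le) (Finset.mem_range.2 hi)

lemma aux14_chain (n : ℕ) (r : ℝ) (hr : 1 ≤ r) (a : ℝ → ℂ) (l : ℕ) :
    ∀ j : ℕ, j < 2 ^ l →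
    (‖a ((2 : ℝ) ^ n + (2 : ℝ) ^ n / (2 : ℝ) ^ l * j) - a ((2 : ℝ) ^ n)‖₊ : ℝ≥0∞) ≤
        ∑ l ∈ Finset.range (l + 1),
          (∑ k ∈ Finset.range (2 ^ l),
            (‖a ((2 : ℝ) ^ n + (2 : ℝ) ^ n / (2 : ℝ) ^ l * (k + 1))
              - a ((2 : ℝ) ^ n + (2 : ℝ) ^ n / (2 : ℝ) ^ l * k)‖₊ : ℝ≥0∞) ^ r) ^ (1 / r) := by
  induction l with
  | zero =>
    intro j hj
    have : j = 0 := by simpa using hj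
    subst this
    simp
  | succ l ih =>
    intro j hj
    rw [Finset.sum_range_succ]
    have hp : ∀ i : ℕ, (2 : ℝ) ^ n + (2 : ℝ) ^ n / (2 : ℝ) ^ (l + 1) * ((2 * i : ℕ) : ℝ)
        = (2 : ℝ) ^ n + (2 : ℝ) ^ n / (2 : ℝ) ^ l * i := by
      intro i
      push_cast
      rw [pow_succ (2 : ℝ) l]
      field_simp
    rw [pow_succ] at hj
    rcases Nat.even_or_odd' j with ⟨i, rfl | rfl⟩
    · rw [hp]
      exact (ih i (by omega)).trans le_self_add
    · have h1 := ih i (by omega)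
      have h2 := aux14_term r hr (fun k : ℕ =>
        (‖a ((2 : ℝ) ^ n + (2 : ℝ) ^ n / (2 : ℝ) ^ (l + 1) * (k + 1))
              - a ((2 : ℝ) ^ n + (2 : ℝ) ^ n / (2 : ℝ) ^ (l + 1) * k)‖₊ : ℝ≥0∞))
        (2 ^ (l + 1)) (2 * i) (by rw [pow_succ]; omega)
      refine le_trans ?_ (add_le_add h1 h2)
      rw [← hp i, ← ENNReal.coe_add, ENNReal.coe_le_coe]
      have e : ((2 * i + 1 : ℕ) : ℝ) = ((2 * i : ℕ) : ℝ) + 1 := by push_cast; ring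
      rw [e, add_comm (‖_‖₊)]
      refine le_trans (le_of_eq ?_) (nnnorm_add_le _ _)
      congr 1
      ring

/-- the numerical Rademacher–Menshov type inequality (Lemma 4.3, case of
the supremum): for a step function `𝔞` on `[2^n, 2^{n+1}]` (i.e. `𝔞(t) = 𝔞(⌊t⌋)`),
`sup_{2^n ≤ t < 2^{n+1}} |𝔞(t) − 𝔞(2^n)| ≤ 2^{1−1/r} Σ_{l=0}^n (Σ_{k<2^l}
|𝔞(2^n + 2^{n−l}(k+1)) − 𝔞(2^n + 2^{n−l}k)|^r)^{1/r}`. -/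
theorem statement14 (n : ℕ) (r : ℝ) (hr : 1 ≤ r) (a : ℝ → ℂ)
    (ha : ∀ t ∈ Set.Icc ((2 : ℝ) ^ n) ((2 : ℝ) ^ (n + 1)), a t = a (⌊t⌋ : ℤ)) :
    (⨆ t : ↥(Set.Ico ((2 : ℝ) ^ n) ((2 : ℝ) ^ (n + 1))),
        (‖a (↑t) - a ((2 : ℝ) ^ n)‖₊ : ℝ≥0∞))
      ≤ ENNReal.ofReal ((2 : ℝ) ^ (1 - 1 / r)) *
        ∑ l ∈ Finset.range (n + 1),
          (∑ k ∈ Finset.range (2 ^ l),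
            (‖a ((2 : ℝ) ^ n + (2 : ℝ) ^ n / (2 : ℝ) ^ l * (k + 1))
              - a ((2 : ℝ) ^ n + (2 : ℝ) ^ n / (2 : ℝ) ^ l * k)‖₊ : ℝ≥0∞) ^ r) ^ (1 / r) := by
  apply iSup_le
  rintro ⟨t, ht1, ht2⟩
  have hc : (1 : ℝ≥0∞) ≤ ENNReal.ofReal ((2 : ℝ) ^ (1 - 1 / r)) := by
    rw [ENNReal.one_le_ofReal]
    apply Real.one_le_rpow (by norm_num)
    have : 1 / r ≤ 1 := by rw [div_le_one (by linarith)]; exact hr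
    linarith
  refine le_trans ?_ (le_mul_of_one_le_left zero_le hc)
  have hf1 : (2 : ℤ) ^ n ≤ ⌊t⌋ := by
    rw [Int.le_floor]; exact_mod_cast ht1
  have hf2 : ⌊t⌋ < (2 : ℤ) ^ (n + 1) := by
    rw [Int.floor_lt]; exact_mod_cast ht2
  obtain ⟨j, hj⟩ := Int.eq_ofNat_of_zero_le (sub_nonneg.2 hf1)
  have hjlt : j < 2 ^ n := by
    rw [pow_succ] at hf2
    zify
    linarith
  have h := aux14_chain n r hr a n j hjlt
  have e : (2 : ℝ) ^ n + (2 : ℝ) ^ n / (2 : ℝ) ^ n * j = ((⌊t⌋ : ℤ) : ℝ) := by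
    have : ⌊t⌋ = 2 ^ n + (j : ℤ) := by linarith
    rw [this, div_self (by positivity)]
    push_cast
    ring
  rw [e, ← ha t ⟨ht1, ht2.le⟩] at h
  exact h
end

section
/- For every n ∈ ℕ₀, every r ≥ 1, and every function 𝔞 : [2^n, 2^{n+1}] → ℂ satisfying 𝔞(t) = 𝔞(⌊t⌋) for all t, the r-variation over the dyadic block satisfies V_r(𝔞(t) : t ∈ [2^n, 2^{n+1})) ≤ 2^{1−1/r} Σ_{l=0}^{n} ( Σ_{k=0}^{2^l − 1} |𝔞(2^n + 2^{n−l}(k+1)) − 𝔞(2^n + 2^{n−l}k)|^r )^{1/r}. -/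
open ENNReal

/-- The `r`-variation seminorm of `t ↦ a t` over the index set `Z ⊆ ℝ`:
the supremum over all finite increasing sequences `t_0 < … < t_J` in `Z` of
`(Σ_j |a(t_{j+1}) - a(t_j)|^r)^{1/r}`. -/
noncomputable def varSem (r : ℝ) (Z : Set ℝ) (a : ℝ → ℂ) : ℝ≥0∞ :=
  ⨆ (J : ℕ) (u : Fin (J + 1) → ℝ) (_ : StrictMono u) (_ : ∀ j, u j ∈ Z),
    (∑ j : Fin J, (‖a (u j.succ) - a (u j.castSucc)‖₊ : ℝ≥0∞) ^ r) ^ (1 / r)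

lemma aux_disj {ι : Type} (S : Finset ι) (p q : ι → ℕ) (N : ℕ) (d : ℕ → ℝ≥0∞)
    (hq : ∀ j ∈ S, q j ≤ N)
    (hd : (S : Set ι).PairwiseDisjoint (fun j => Finset.Ico (p j) (q j))) :
    ∑ j ∈ S, ∑ k ∈ Finset.Ico (p j) (q j), d k ≤ ∑ k ∈ Finset.range N, d k := by
  classical
  rw [← Finset.sum_biUnion hd]
  apply Finset.sum_le_sum_of_subset
  intro k hk
  simp only [Finset.mem_biUnion, Finset.mem_Ico, Finset.mem_range] at *
  obtain ⟨j, hj, h⟩ := hk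
  have := hq j hj
  omega

lemma aux_two (b : ℕ → ℂ) (r : ℝ) (hr : 1 ≤ r) (p q : ℕ) (hpq : p < q) :
    (‖b (2 * ((p + 1) / 2)) - b p‖₊ : ℝ≥0∞) ^ r + (‖b q - b (2 * (q / 2))‖₊ : ℝ≥0∞) ^ r
      ≤ ∑ k ∈ Finset.Ico p q, (‖b (k + 1) - b k‖₊ : ℝ≥0∞) ^ r := by
  have h0 : (0 : ℝ≥0∞) ^ r = 0 := ENNReal.zero_rpow_of_pos (by linarith)
  have key : ∀ x y : ℕ, x ≤ y → y ≤ x + 1 → (‖b y - b x‖₊ : ℝ≥0∞) ^ r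
      = ∑ k ∈ Finset.Ico x y, (‖b (k + 1) - b k‖₊ : ℝ≥0∞) ^ r := by
    intro x y h1 h2
    obtain rfl | rfl : y = x ∨ y = x + 1 := by omega
    · simp [h0]
    · simp
  rw [key p _ (by omega) (by omega), key _ q (by omega) (by omega),
    ← Finset.sum_Ico_consecutive _ (show p ≤ 2 * ((p + 1) / 2) by omega)
      (show 2 * ((p + 1) / 2) ≤ q by omega),
    ← Finset.sum_Ico_consecutive _ (show 2 * ((p + 1) / 2) ≤ 2 * (q / 2) by omega)
      (show 2 * (q / 2) ≤ q by omega)]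
  gcongr
  exact le_add_self

lemma aux_main {ι : Type} (r : ℝ) (hr : 1 ≤ r) (n : ℕ) : ∀ (b : ℕ → ℂ) (S : Finset ι)
    (p q : ι → ℕ) (_ : ∀ j ∈ S, p j < q j) (_ : ∀ j ∈ S, q j ≤ 2 ^ n)
    (_ : (S : Set ι).PairwiseDisjoint (fun j => Finset.Ico (p j) (q j))),
    (∑ j ∈ S, (‖b (q j) - b (p j)‖₊ : ℝ≥0∞) ^ r) ^ (1 / r) ≤
      (2 : ℝ≥0∞) ^ (1 - 1 / r) * ∑ l ∈ Finset.range (n + 1),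
          (∑ k ∈ Finset.range (2 ^ l),
            (‖b (2 ^ (n - l) * (k + 1)) - b (2 ^ (n - l) * k)‖₊ : ℝ≥0∞) ^ r) ^ (1 / r) := by
  have hr0 : 0 < r := by linarith
  have hir : 0 ≤ 1 / r := by positivity
  have hir1 : 1 / r ≤ 1 := by rw [div_le_one hr0]; exact hr
  induction n with
  | zero =>
    intro b S p q hpq hq hd
    have h1 : (1 : ℝ≥0∞) ≤ (2 : ℝ≥0∞) ^ (1 - 1 / r) :=
      ENNReal.one_rpow (1 - 1 / r) ▸
        ENNReal.rpow_le_rpow (z := 1 - 1 / r) one_le_two (by linarith)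
    have h2 := aux_disj S p q _ (fun k => (‖b (k + 1) - b k‖₊ : ℝ≥0∞) ^ r) hq hd
    have h3 : ∑ j ∈ S, (‖b (q j) - b (p j)‖₊ : ℝ≥0∞) ^ r ≤
        ∑ j ∈ S, ∑ k ∈ Finset.Ico (p j) (q j), (‖b (k + 1) - b k‖₊ : ℝ≥0∞) ^ r := by
      apply Finset.sum_le_sum
      intro j hj
      have e1 := hpq j hj
      have e2 := hq j hj
      have e3 : p j = 0 := by simp at e2; omega
      have e4 : q j = 1 := by simp at e2; omega
      simp [e3, e4]
    have h4 := ENNReal.rpow_le_rpow (h3.trans h2) hir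
    refine h4.trans ?_
    refine le_trans ?_ (mul_le_mul_left h1 _)
    simp
  | succ n ih =>
    intro b S p q hpq hq hd
    rw [Finset.sum_range_succ, mul_add, add_comm]
    have tri : ∀ j ∈ S, (‖b (q j) - b (p j)‖₊ : ℝ≥0∞) ≤
      ((‖b (2 * ((p j + 1) / 2)) - b (p j)‖₊ : ℝ≥0∞) + (‖b (q j) - b (2 * (q j / 2))‖₊ : ℝ≥0∞))
        + (‖b (2 * (q j / 2)) - b (2 * ((p j + 1) / 2))‖₊ : ℝ≥0∞) := by
      intro j _
      norm_cast
      have : b (q j) - b (p j) = ((b (2 * ((p j + 1) / 2)) - b (p j)) + (b (q j) - b (2 * (q j / 2))))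
        + (b (2 * (q j / 2)) - b (2 * ((p j + 1) / 2))) := by ring
      rw [this]
      exact (nnnorm_add_le _ _).trans (add_le_add_left (nnnorm_add_le _ _) _)
    have hA : (∑ j ∈ S, (‖b (q j) - b (p j)‖₊ : ℝ≥0∞) ^ r) ^ (1 / r) ≤ _ :=
      (ENNReal.rpow_le_rpow (Finset.sum_le_sum fun j hj =>
        ENNReal.rpow_le_rpow (tri j hj) hr0.le) hir).trans (ENNReal.Lp_add_le S _ _ hr)
    refine hA.trans (add_le_add ?_ ?_)
    · have h2 := aux_disj S p q _ (fun k => (‖b (k + 1) - b k‖₊ : ℝ≥0∞) ^ r) hq hd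
      have h3 : ∑ j ∈ S, ((‖b (2 * ((p j + 1) / 2)) - b (p j)‖₊ : ℝ≥0∞) +
          (‖b (q j) - b (2 * (q j / 2))‖₊ : ℝ≥0∞)) ^ r ≤
          2 ^ (r - 1) * ∑ k ∈ Finset.range (2 ^ (n + 1)), (‖b (k + 1) - b k‖₊ : ℝ≥0∞) ^ r := by
        refine le_trans ?_ (mul_le_mul_right h2 _)
        rw [Finset.mul_sum]
        apply Finset.sum_le_sum
        intro j hj
        exact (ENNReal.rpow_add_le_mul_rpow_add_rpow _ _ hr).trans
          (mul_le_mul_right (aux_two b r hr _ _ (hpq j hj)) _)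
      refine (ENNReal.rpow_le_rpow h3 hir).trans ?_
      rw [ENNReal.mul_rpow_of_nonneg _ _ hir, ← ENNReal.rpow_mul]
      have : (r - 1) * (1 / r) = 1 - 1 / r := by field_simp
      rw [this]
      simp
    · set S' := S.filter (fun j => (p j + 1) / 2 < q j / 2) with hS'
      have := ih (fun m => b (2 * m)) S' (fun j => (p j + 1) / 2) (fun j => q j / 2)
        (by intro j hj; simpa using (Finset.mem_filter.1 hj).2)
        (by intro j hj; have := hq j (Finset.mem_filter.1 hj).1; rw [pow_succ] at this
            show q j / 2 ≤ 2 ^ n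
            omega)
        (by
          intro i hi j hj hij
          have h := hd (Finset.mem_filter.1 hi).1 (Finset.mem_filter.1 hj).1 hij
          simp only [Function.onFun, Finset.disjoint_left, Finset.mem_Ico] at h ⊢
          intro k hk hk'
          exact h (a := 2 * k) (by omega) (by omega))
      have e : ∑ j ∈ S, (‖b (2 * (q j / 2)) - b (2 * ((p j + 1) / 2))‖₊ : ℝ≥0∞) ^ r =
          ∑ j ∈ S', (‖b (2 * (q j / 2)) - b (2 * ((p j + 1) / 2))‖₊ : ℝ≥0∞) ^ r := by
        symm
        apply Finset.sum_subset (Finset.filter_subset _ _)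
        intro j hj hj'
        have h1 := hpq j hj
        have h2 : ¬ ((p j + 1) / 2 < q j / 2) := fun h => hj' (Finset.mem_filter.2 ⟨hj, h⟩)
        have : q j / 2 = (p j + 1) / 2 := by omega
        simp [this, hr0]
      rw [e]
      refine this.trans (le_of_eq ?_)
      congr 1
      apply Finset.sum_congr rfl
      intro l hl
      have hl' : n + 1 - l = (n - l) + 1 := by have := Finset.mem_range.1 hl; omega
      simp only [hl', pow_succ, mul_assoc, mul_left_comm]

theorem statement15 (n : ℕ) (r : ℝ) (hr : 1 ≤ r) (a : ℝ → ℂ)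
    (ha : ∀ t ∈ Set.Icc ((2 : ℝ) ^ n) ((2 : ℝ) ^ (n + 1)), a t = a (⌊t⌋ : ℤ)) :
    varSem r (Set.Ico ((2 : ℝ) ^ n) ((2 : ℝ) ^ (n + 1))) a
      ≤ ENNReal.ofReal ((2 : ℝ) ^ (1 - 1 / r)) *
        ∑ l ∈ Finset.range (n + 1),
          (∑ k ∈ Finset.range (2 ^ l),
            (‖a ((2 : ℝ) ^ n + (2 : ℝ) ^ n / (2 : ℝ) ^ l * (k + 1))
              - a ((2 : ℝ) ^ n + (2 : ℝ) ^ n / (2 : ℝ) ^ l * k)‖₊ : ℝ≥0∞) ^ r) ^ (1 / r) := by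
  have hr0 : 0 < r := by linarith
  unfold varSem
  refine iSup_le fun J => iSup_le fun u => iSup_le fun hu => iSup_le fun hZ => ?_
  set b : ℕ → ℂ := fun m => a ((2 : ℝ) ^ n + m) with hb
  set m : Fin (J + 1) → ℕ := fun j => ⌊u j⌋₊ - 2 ^ n with hm
  have hlow : ∀ j, 2 ^ n ≤ ⌊u j⌋₊ := fun j => Nat.le_floor (by push_cast; exact (hZ j).1)
  have hmono : Monotone m := fun i j hij =>
    Nat.sub_le_sub_right (Nat.floor_mono (hu.monotone hij)) _
  have hup : ∀ j, m j ≤ 2 ^ n := by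
    intro j
    have : ⌊u j⌋₊ ≤ 2 ^ (n + 1) := by
      apply Nat.floor_le_of_le
      push_cast
      exact (hZ j).2.le
    rw [pow_succ] at this
    show ⌊u j⌋₊ - 2 ^ n ≤ 2 ^ n
    omega
  have hau : ∀ j, a (u j) = b (m j) := by
    intro j
    rw [ha _ ⟨(hZ j).1, (hZ j).2.le⟩]
    simp only [hb, hm]
    congr 1
    rw [Nat.cast_sub (hlow j)]
    have h0 : 0 ≤ u j := le_trans (by positivity) (hZ j).1
    rw [natCast_floor_eq_intCast_floor h0]
    push_cast
    ring
  simp only [hau]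
  set S : Finset (Fin J) := Finset.univ.filter (fun j => m j.castSucc < m j.succ) with hS
  have e : ∑ j : Fin J, (‖b (m j.succ) - b (m j.castSucc)‖₊ : ℝ≥0∞) ^ r =
      ∑ j ∈ S, (‖b (m j.succ) - b (m j.castSucc)‖₊ : ℝ≥0∞) ^ r := by
    symm
    apply Finset.sum_subset (Finset.filter_subset _ _)
    intro j hj hj'
    have h2 : ¬ (m j.castSucc < m j.succ) := fun h => hj' (Finset.mem_filter.2 ⟨hj, h⟩)
    have h3 := hmono (Fin.castSucc_lt_succ (i := j)).le
    have : m j.succ = m j.castSucc := by omega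
    simp [this, hr0]
  rw [e]
  have key := aux_main r hr n b S (fun j => m j.castSucc) (fun j => m j.succ)
    (fun j hj => (Finset.mem_filter.1 hj).2) (fun j _ => hup _)
    (by
      have aux : ∀ i j : Fin J, i < j → m i.succ ≤ m j.castSucc := fun i j h =>
        hmono (Fin.le_def.2 (by simpa using Nat.succ_le_of_lt (Fin.lt_def.1 h)))
      intro i _ j _ hij
      simp only [Function.onFun, Finset.disjoint_left, Finset.mem_Ico]
      intro k hk hk'
      rcases lt_or_gt_of_ne hij with h | h
      · have := aux _ _ h; omega
      · have := aux _ _ h; omega)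
  refine key.trans (le_of_eq ?_)
  rw [← ENNReal.ofReal_rpow_of_pos (by norm_num)]
  congr 1
  · simp
  · apply Finset.sum_congr rfl
    intro l hl
    have hl' : l ≤ n := by have := Finset.mem_range.1 hl; omega
    have h2 : (2 : ℝ) ^ n / (2 : ℝ) ^ l = 2 ^ (n - l) := by
      rw [pow_sub₀ _ (by norm_num) hl']; rfl
    simp only [hb, h2]
    push_cast
    rfl
end
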